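/- Let h ≥ 1 and let Γ be a simple graph whose vertex set V is partitioned into h color classes V_1, …, V_h, such that no edge joins two vertices of the same color. Suppose that for every color i: (1) V_i contains at least two elements, and (2) for every choice of 2(h−1) vertices u^1, …, u^{2(h−1)} in V ∖ V_i there exist two distinct vertices v, w ∈ V_i each adjacent to every u^j. Then the flag complex K(Γ), whose simplices are the finite cliques of Γ, has the homotopy type of a bouquet (wedge) of (h−1)-spheres. -/

import Mathlib

open Function

/-- The `n`-sphere, realized as the unit sphere in Euclidean `(n+1)`-space. -/
abbrev Sphere (n : ℕ) : Type := Metric.sphere (0 : EuclideanSpace ℝ (Fin (n + 1))) 1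

/-- A base point on the `n`-sphere. -/
noncomputable def spherePt (n : ℕ) : Sphere n :=
  ⟨EuclideanSpace.single 0 1, by
    rw [mem_sphere_zero_iff_norm, EuclideanSpace.norm_single]
    norm_num⟩

/-- A bouquet (wedge sum) of copies of the `n`-sphere indexed by `ι` (a single point if
`ι` is empty): the quotient of `pt ⊔ (ι × Sphere n)` identifying `pt` with all the base
points, equipped with the quotient topology. -/
def Bouquet (ι : Type) (n : ℕ) : Type :=
  Quot fun x y : Unit ⊕ (Σ _ : ι, Sphere n) =>
    (x = Sum.inl () ∨ ∃ p : Σ _ : ι, Sphere n, x = Sum.inr p ∧ p.2 = spherePt n) ∧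
    (y = Sum.inl () ∨ ∃ p : Σ _ : ι, Sphere n, y = Sum.inr p ∧ p.2 = spherePt n)

/-- The geometric realization of the flag complex `K(Γ)` of a simple graph `Γ`: formal
convex combinations of vertices whose support is a (finite) clique. -/
def FlagRealization {V : Type} (G : SimpleGraph V) : Type :=
  {f : V → ℝ // (∀ v, 0 ≤ f v) ∧ (Function.support f).Finite ∧
    G.IsClique (Function.support f) ∧ ∑ᶠ v, f v = 1}

noncomputable instance (ι : Type) (n : ℕ) : TopologicalSpace (Bouquet ι n) :=
  inferInstanceAs (TopologicalSpace (Quot _))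

instance {V : Type} (G : SimpleGraph V) : TopologicalSpace (FlagRealization G) :=
  inferInstanceAs (TopologicalSpace (Subtype _))
section

open scoped unitInterval Topology
open ContinuousMap Set

/-- Continuous real functions on the unit sphere which extend to smooth functions. -/
def smoothRestrictions (E : Type*) [NormedAddCommGroup E] [NormedSpace ℝ E] :
    Subalgebra ℝ C(Metric.sphere (0 : E) 1, ℝ) where
  carrier := {f | ∃ F : E → ℝ, ContDiff ℝ 1 F ∧ ∀ x, f x = F x}
  mul_mem' := by
    rintro f g ⟨F, hF, hf⟩ ⟨G, hG, hg⟩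
    exact ⟨fun x => F x * G x, hF.mul hG, fun x => by simp [hf, hg]⟩
  add_mem' := by
    rintro f g ⟨F, hF, hf⟩ ⟨G, hG, hg⟩
    exact ⟨fun x => F x + G x, hF.add hG, fun x => by simp [hf, hg]⟩
  algebraMap_mem' r := ⟨fun _ => r, contDiff_const, fun x => by simp⟩

theorem smoothRestrictions_separatesPoints (E : Type*) [NormedAddCommGroup E]
    [InnerProductSpace ℝ E] : (smoothRestrictions E).SeparatesPoints := by
  intro x y hxy
  refine ⟨_, ⟨⟨fun z => inner ℝ (z : E) (x - y : E), by fun_prop⟩,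
    ⟨fun z => inner ℝ z (x - y : E), contDiff_id.inner ℝ contDiff_const, fun _ => rfl⟩, rfl⟩,
    fun h => hxy ?_⟩
  have h' : inner ℝ (x - y : E) (x - y : E) = 0 := by
    rw [inner_sub_left]
    exact sub_eq_zero.2 h
  exact Subtype.ext (sub_eq_zero.1 (inner_self_eq_zero.1 h'))

theorem exists_contDiff_near {m k : ℕ} (f : C(Sphere m, EuclideanSpace ℝ (Fin k))) {ε : ℝ}
    (hε : 0 < ε) : ∃ F : EuclideanSpace ℝ (Fin (m + 1)) → EuclideanSpace ℝ (Fin k),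
      ContDiff ℝ 1 F ∧ ∀ x : Sphere m, ‖F x - f x‖ < ε := by
  have key : ∀ δ > 0, ∀ j, ∃ F : EuclideanSpace ℝ (Fin (m + 1)) → ℝ, ContDiff ℝ 1 F ∧
      ∀ x : Sphere m, |F x - f x j| < δ := by
    intro δ hδ j
    obtain ⟨⟨g, F, hF, hg⟩, h⟩ := exists_mem_subalgebra_near_continuousMap_of_separatesPoints _
      (smoothRestrictions_separatesPoints _) ⟨fun x => f x j, by fun_prop⟩ δ hδ
    refine ⟨F, hF, fun x => ?_⟩
    have := (ContinuousMap.norm_lt_iff _ hδ).1 h x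
    simpa [hg] using this
  have hδ : 0 < ε / (k + 1) := by positivity
  choose F hF h using key _ hδ
  refine ⟨fun x => WithLp.toLp 2 fun j => F j x, ?_, fun x => ?_⟩
  · rw [contDiff_euclidean]
    exact hF
  · have h1 : ‖(WithLp.toLp 2 fun j => F j x) - f x‖ ≤ ∑ j, |F j x - f x j| := by
      rw [EuclideanSpace.norm_eq, Real.sqrt_le_left (by positivity)]
      have := Finset.sum_sq_le_sq_sum_of_nonneg (s := Finset.univ)
        (f := fun j => |F j x - f x j|) (fun _ _ => abs_nonneg _)
      simpa using this
    have h2 : ∑ j, |F j x - f x j| ≤ ∑ _j : Fin k, ε / (k + 1) :=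
      Finset.sum_le_sum fun j _ => (h j x).le
    refine (h1.trans h2).trans_lt ?_
    simp only [Finset.sum_const, Finset.card_univ, Fintype.card_fin, nsmul_eq_mul]
    rw [← mul_div_assoc, div_lt_iff₀ (by positivity)]
    nlinarith

/-- A map from the `m`-sphere to `ℝ^(m+2)` can be perturbed to avoid a given line. -/
theorem exists_near_avoiding_line {m : ℕ} (f : C(Sphere m, EuclideanSpace ℝ (Fin (m + 1 + 1))))
    (q : EuclideanSpace ℝ (Fin (m + 1 + 1))) {ε : ℝ} (hε : 0 < ε) :
    ∃ p : C(Sphere m, EuclideanSpace ℝ (Fin (m + 1 + 1))),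
      (∀ x, ‖p x - f x‖ < ε) ∧ ∀ x (r : ℝ), p x ≠ r • q := by
  obtain ⟨F, hF, hFf⟩ := exists_contDiff_near f (half_pos hε)
  set v := spherePt m
  have hv : ‖(v : EuclideanSpace ℝ (Fin (m + 1)))‖ = 1 := mem_sphere_zero_iff_norm.1 v.2
  let v' : EuclideanSpace ℝ (Fin (m + 1)) := v
  let A : ((ℝ ∙ v')ᗮ × ℝ) → EuclideanSpace ℝ (Fin (m + 1 + 1)) :=
    fun y => y.2 • q - F (stereoInvFunAux v' y.1)
  let B : ℝ → EuclideanSpace ℝ (Fin (m + 1 + 1)) := fun r => r • q - F v'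
  have hA : ContDiff ℝ 1 A := by
    have h0 : ContDiff ℝ 1 (stereoInvFunAux v') := contDiff_stereoInvFunAux
    have h1 : ContDiff ℝ 1 fun y : (ℝ ∙ v')ᗮ × ℝ => (y.1 : EuclideanSpace ℝ (Fin (m + 1))) :=
      (ℝ ∙ v')ᗮ.subtypeL.contDiff.comp contDiff_fst
    exact (contDiff_snd.smul contDiff_const).sub (hF.comp (h0.comp h1))
  have hB : ContDiff ℝ 1 B := (contDiff_id.smul contDiff_const).sub contDiff_const
  have hv0 : v' ≠ 0 := by
    rintro h
    simp [v', h] at hv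
  have hfr : Module.finrank ℝ (ℝ ∙ v')ᗮ = m := by
    have : Fact (Module.finrank ℝ (EuclideanSpace ℝ (Fin (m + 1))) = m + 1) := ⟨by simp⟩
    exact Submodule.finrank_orthogonal_span_singleton hv0
  have hd : Dense (range A ∪ range B)ᶜ := by
    apply dense_compl_of_dimH_lt_finrank
    rw [dimH_union, max_lt_iff]
    refine ⟨hA.dimH_range_le.trans_lt ?_, hB.dimH_range_le.trans_lt ?_⟩
    · rw [Module.finrank_prod, hfr]
      simp only [Module.finrank_self, finrank_euclideanSpace, Fintype.card_fin]
      exact_mod_cast Nat.lt_succ_self _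
    · simp only [Module.finrank_self, finrank_euclideanSpace, Fintype.card_fin]
      exact_mod_cast (by omega : 1 < m + 1 + 1)
  obtain ⟨u, hu, hu'⟩ := hd.exists_dist_lt 0 (half_pos hε)
  rw [dist_zero_left] at hu'
  refine ⟨⟨fun x => F x + u, by have := hF.continuous; fun_prop⟩, fun x => ?_, fun x r h => hu ?_⟩
  · calc ‖F x + u - f x‖ = ‖(F x - f x) + u‖ := by congr 1; abel
      _ ≤ ‖F x - f x‖ + ‖u‖ := norm_add_le _ _
      _ < ε := by linarith [hFf x]
  · have h : F x + u = r • q := h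
    have h' : r • q - F x = u := by rw [← h]; abel
    by_cases hx : (x : EuclideanSpace ℝ (Fin (m + 1))) = v'
    · exact Or.inr ⟨r, by simp only [B]; rw [← hx, h']⟩
    · refine Or.inl ⟨(stereoToFun v' x, r), ?_⟩
      have h3 : stereoInvFunAux v' (stereoToFun v' (x : EuclideanSpace ℝ (Fin (m + 1)))) = x :=
        congrArg Subtype.val (stereo_left_inv (v := v') hv hx)
      simp only [A]
      rw [h3, h']

section ProductContinuity

variable {P Y : Type*} [TopologicalSpace P] [TopologicalSpace Y]

theorem continuous_prod_sum {A B : Type*} [TopologicalSpace A] [TopologicalSpace B]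
    {F : P × (A ⊕ B) → Y} (hl : Continuous fun x : P × A => F (x.1, Sum.inl x.2))
    (hr : Continuous fun x : P × B => F (x.1, Sum.inr x.2)) : Continuous F := by
  rw [← (Homeomorph.prodSumDistrib (X := P) (Y := A) (Z := B)).symm.comp_continuous_iff']
  exact continuous_sum_dom.2 ⟨hl, hr⟩

theorem continuous_prod_sigma {ι : Type*} {A : ι → Type*} [∀ i, TopologicalSpace (A i)]
    {F : P × (Σ i, A i) → Y} (h : ∀ i, Continuous fun x : P × A i => F (x.1, ⟨i, x.2⟩)) :
    Continuous F := by
  have h' : Continuous (F ∘ Prod.swap) := by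
    rw [← (Homeomorph.sigmaProdDistrib (X := A) (Y := P)).symm.comp_continuous_iff']
    exact continuous_sigma fun i => (h i).comp continuous_swap
  exact h'.comp continuous_swap

end ProductContinuity

namespace Bouquet

variable {ι : Type} {n : ℕ}

/-- The wedge point. -/
def base : Bouquet ι n := Quot.mk _ (Sum.inl ())

/-- The inclusion of the sphere of index `i`. -/
def inSphere (i : ι) (z : Sphere n) : Bouquet ι n := Quot.mk _ (Sum.inr ⟨i, z⟩)

@[simp] theorem inSphere_spherePt (i : ι) : inSphere i (spherePt n) = base :=
  Quot.sound ⟨Or.inr ⟨_, rfl, rfl⟩, Or.inl rfl⟩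

theorem cases_on (b : Bouquet ι n) : b = base ∨ ∃ i z, b = inSphere i z := by
  rcases b with ⟨⟨⟩ | ⟨i, z⟩⟩
  · exact Or.inl rfl
  · exact Or.inr ⟨i, z, rfl⟩

theorem isQuotientMap_mk : Topology.IsQuotientMap (Quot.mk _ : _ → Bouquet ι n) :=
  isQuotientMap_quot_mk

theorem continuous_prod {P Y : Type*} [TopologicalSpace P] [LocallyCompactSpace P]
    [TopologicalSpace Y] {F : P × Bouquet ι n → Y} (h0 : Continuous fun p => F (p, base))
    (h : ∀ i, Continuous fun x : P × Sphere n => F (x.1, inSphere i x.2)) : Continuous F :=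
  isQuotientMap_mk.continuous_lift_prod_right
    (continuous_prod_sum (h0.comp continuous_fst) (continuous_prod_sigma h))

theorem continuous_of {Y : Type*} [TopologicalSpace Y] {F : Bouquet ι n → Y}
    (h : ∀ i, Continuous fun x => F (inSphere i x)) : Continuous F :=
  isQuotientMap_mk.continuous_iff.2
    (continuous_sum_dom.2 ⟨continuous_of_const fun _ _ => rfl, continuous_sigma h⟩)

theorem continuous_inSphere (i : ι) : Continuous (inSphere (n := n) i) :=
  isQuotientMap_mk.continuous.comp (continuous_inr.comp continuous_sigmaMk)

/-- The map out of a bouquet given by maps on the spheres. -/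
def lift {Y : Type*} (y : Y) (g : ι → Sphere n → Y) (h : ∀ i, g i (spherePt n) = y) :
    Bouquet ι n → Y :=
  Quot.lift (Sum.elim (fun _ => y) fun p => g p.1 p.2) (by
    have key : ∀ x : Unit ⊕ (Σ _ : ι, Sphere n),
        (x = Sum.inl () ∨ ∃ p : Σ _ : ι, Sphere n, x = Sum.inr p ∧ p.2 = spherePt n) →
        Sum.elim (fun _ => y) (fun p => g p.1 p.2) x = y := by
      rintro _ (rfl | ⟨⟨i, _⟩, rfl, rfl⟩)
      · rfl
      · exact h i
    rintro a b ⟨ha, hb⟩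
    rw [key a ha, key b hb])

@[simp] theorem lift_base {Y : Type*} (y : Y) (g : ι → Sphere n → Y) (h) :
    lift y g h base = y := rfl

@[simp] theorem lift_inSphere {Y : Type*} (y : Y) (g : ι → Sphere n → Y) (h) (i z) :
    lift y g h (inSphere i z) = g i z := rfl

/-- The map identifying all the spheres of a bouquet. -/
noncomputable def fold : C(Bouquet ι n, Sphere n) where
  toFun := lift (spherePt n) (fun _ z => z) fun _ => rfl
  continuous_toFun := continuous_of fun _ => continuous_id

@[simp] theorem fold_inSphere (i : ι) (z : Sphere n) : fold (inSphere i z) = z := rfl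

/-- A family of pointed self-maps of the sphere acts on each bouquet. -/
noncomputable def mapFamily {P : Type*} [TopologicalSpace P] [LocallyCompactSpace P]
    (T : C(P × Sphere n, Sphere n)) (hT : ∀ p, T (p, spherePt n) = spherePt n) :
    C(P × Bouquet ι n, Bouquet ι n) where
  toFun x := lift base (fun i z => inSphere i (T (x.1, z))) (fun i => by simp [hT]) x.2
  continuous_toFun := continuous_prod continuous_const fun i => by
    simp only [lift_inSphere]
    exact (continuous_inSphere i).comp T.continuous

section

variable {P : Type*} [TopologicalSpace P] [LocallyCompactSpace P]
    (T : C(P × Sphere n, Sphere n)) (hT : ∀ p, T (p, spherePt n) = spherePt n)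

@[simp] theorem mapFamily_inSphere (p : P) (i : ι) (z : Sphere n) :
    mapFamily T hT (p, inSphere i z) = inSphere i (T (p, z)) := rfl

theorem mapFamily_eq_self {p : P} {b : Bouquet ι n} (h : T (p, fold b) = fold b) :
    mapFamily T hT (p, b) = b := by
  rcases b.cases_on with rfl | ⟨i, z, rfl⟩
  · rfl
  · rw [mapFamily_inSphere]
    exact congrArg _ h

theorem mapFamily_eq_base {p : P} {b : Bouquet ι n} (h : T (p, fold b) = spherePt n) :
    mapFamily T hT (p, b) = base := by
  rcases b.cases_on with rfl | ⟨i, z, rfl⟩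
  · rfl
  · rw [mapFamily_inSphere]
    rw [fold_inSphere] at h
    rw [h, inSphere_spherePt]

theorem fold_mapFamily (p : P) (b : Bouquet ι n) :
    fold (mapFamily T hT (p, b)) = T (p, fold b) := by
  rcases b.cases_on with rfl | ⟨i, z, rfl⟩
  · exact (hT p).symm
  · rfl

end

end Bouquet

/-- The radial projection of a nowhere vanishing map to the unit sphere. -/
noncomputable def normalizeMap {Y : Type*} [TopologicalSpace Y] {n : ℕ}
    (u : C(Y, EuclideanSpace ℝ (Fin (n + 1)))) (hu : ∀ y, u y ≠ 0) : C(Y, Sphere n) where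
  toFun y := ⟨‖u y‖⁻¹ • u y, by simp [norm_smul, hu y]⟩
  continuous_toFun := by
    have : Continuous fun y => ‖u y‖⁻¹ :=
      (continuous_norm.comp u.continuous).inv₀ fun y => norm_ne_zero_iff.2 (hu y)
    exact Continuous.subtype_mk (this.smul u.continuous) _

theorem normalizeMap_coe {Y : Type*} [TopologicalSpace Y] {n : ℕ}
    (u : C(Y, EuclideanSpace ℝ (Fin (n + 1)))) (hu : ∀ y, u y ≠ 0) (y : Y) :
    (normalizeMap u hu y : EuclideanSpace ℝ (Fin (n + 1))) = ‖u y‖⁻¹ • u y := rfl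

theorem normalizeMap_eq {Y : Type*} [TopologicalSpace Y] {n : ℕ}
    (u : C(Y, EuclideanSpace ℝ (Fin (n + 1)))) (hu : ∀ y, u y ≠ 0) {y : Y} {z : Sphere n}
    (h : u y = z) : normalizeMap u hu y = z := by
  apply Subtype.ext
  have : ‖(z : EuclideanSpace ℝ (Fin (n + 1)))‖ = 1 := mem_sphere_zero_iff_norm.1 z.2
  rw [normalizeMap_coe, h, this, inv_one, one_smul]

namespace Sphere

variable {n : ℕ}

theorem norm_coe (z : Sphere n) : ‖(z : EuclideanSpace ℝ (Fin (n + 1)))‖ = 1 :=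
  mem_sphere_zero_iff_norm.1 z.2

theorem abs_apply_le (z : EuclideanSpace ℝ (Fin (n + 1))) (i) : |z i| ≤ ‖z‖ :=
  PiLp.norm_apply_le z i

theorem abs_coord_le (z : Sphere n) (i) : |(z : EuclideanSpace ℝ (Fin (n + 1))) i| ≤ 1 :=
  (abs_apply_le _ i).trans (norm_coe z).le

theorem spherePt_coe : (spherePt n : EuclideanSpace ℝ (Fin (n + 1))) = EuclideanSpace.single 0 1 :=
  rfl

theorem spherePt_zero : (spherePt n : EuclideanSpace ℝ (Fin (n + 1))) 0 = 1 := by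
  simp [spherePt_coe]

theorem eq_neg_spherePt (z : Sphere n) (h : (z : EuclideanSpace ℝ (Fin (n + 1))) 0 = -1) :
    (z : EuclideanSpace ℝ (Fin (n + 1))) = -(spherePt n : EuclideanSpace ℝ (Fin (n + 1))) := by
  rw [← inner_eq_one_iff_of_norm_eq_one (𝕜 := ℝ) (norm_coe z) (by rw [norm_neg, norm_coe]),
    inner_neg_right, spherePt_coe, EuclideanSpace.inner_single_right]
  simp [h]

end Sphere

/-- A map to a bouquet whose image stays off the antipodes of the wedge point is homotopic to the
constant map. -/
theorem homotopic_base_of_fold_gt {ι : Type} {m n : ℕ} (g : C(Sphere m, Bouquet ι n))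
    (hg : ∀ x, -1 < (Bouquet.fold (g x) : EuclideanSpace ℝ (Fin (n + 1))) 0) :
    g.Homotopic (.const _ Bouquet.base) := by
  obtain ⟨x₀, -, hx₀⟩ := isCompact_univ.exists_isMinOn ⟨spherePt m, mem_univ _⟩
    (f := fun x => (Bouquet.fold (g x) : EuclideanSpace ℝ (Fin (n + 1))) 0)
    (by fun_prop)
  set δ := (Bouquet.fold (g x₀) : EuclideanSpace ℝ (Fin (n + 1))) 0 + 1 with hδ
  have hδ0 : 0 < δ := by linarith [hg x₀]
  have hmin : ∀ x, δ ≤ (Bouquet.fold (g x) : EuclideanSpace ℝ (Fin (n + 1))) 0 + 1 := fun x =>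
    add_le_add_left (hx₀ (mem_univ x)) 1
  let sc : I × Sphere n → ℝ := fun y =>
    y.1 * min 1 (((y.2 : EuclideanSpace ℝ (Fin (n + 1))) 0 + 1) / δ)
  have hsc : Continuous sc := by fun_prop
  let u : C(I × Sphere n, EuclideanSpace ℝ (Fin (n + 1))) :=
    ⟨fun y => (1 - sc y) • (y.2 : EuclideanSpace ℝ (Fin (n + 1))) +
      sc y • (spherePt n : EuclideanSpace ℝ (Fin (n + 1))), by fun_prop⟩
  have hu : ∀ y, u y ≠ 0 := by
    rintro ⟨s, z⟩ h
    have h1 : (1 - sc (s, z)) • (z : EuclideanSpace ℝ (Fin (n + 1))) =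
      -(sc (s, z) • (spherePt n : EuclideanSpace ℝ (Fin (n + 1)))) := eq_neg_of_add_eq_zero_left h
    have h2 := congrArg norm h1
    rw [norm_neg, norm_smul, norm_smul, Sphere.norm_coe, Sphere.norm_coe, mul_one, mul_one,
      Real.norm_eq_abs, Real.norm_eq_abs, abs_eq_abs] at h2
    have h3 : sc (s, z) = 1 / 2 := by
      rcases h2 with h2 | h2 <;> linarith
    have h4 : (z : EuclideanSpace ℝ (Fin (n + 1))) 0 = -1 := by
      have := congrArg (fun w : EuclideanSpace ℝ (Fin (n + 1)) => w 0) h1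
      simp only [h3, PiLp.smul_apply, PiLp.neg_apply, Sphere.spherePt_zero, smul_eq_mul] at this
      linarith
    simp [sc, h4] at h3
  let T := normalizeMap u hu
  have hT : ∀ s, T (s, spherePt n) = spherePt n := fun s =>
    normalizeMap_eq _ _ (by simp only [u, ContinuousMap.coe_mk, ← add_smul]; simp)
  refine ⟨⟨(Bouquet.mapFamily T hT).comp ((ContinuousMap.id I).prodMap g), fun x => ?_,
    fun x => ?_⟩⟩
  · refine Bouquet.mapFamily_eq_self T hT (normalizeMap_eq _ _ ?_)
    simp [u, sc]
  · refine Bouquet.mapFamily_eq_base T hT (normalizeMap_eq _ _ ?_)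
    have : 1 ≤ ((Bouquet.fold (g x) : EuclideanSpace ℝ (Fin (n + 1))) 0 + 1) / δ :=
      (one_le_div hδ0).2 (hmin x)
    simp [u, sc, min_eq_left this]

/-- A bouquet of `(m+1)`-spheres has trivial `m`-th homotopy. -/
theorem sphere_to_bouquet_homotopic_base {ι : Type} {m : ℕ} (f : C(Sphere m, Bouquet ι (m + 1))) :
    f.Homotopic (.const _ Bouquet.base) := by
  let F : C(Sphere m, EuclideanSpace ℝ (Fin (m + 1 + 1))) :=
    ⟨fun x => Bouquet.fold (f x), by fun_prop⟩
  obtain ⟨p, hpF, hp⟩ := exists_near_avoiding_line F (spherePt (m + 1)) (ε := 1 / 4) (by norm_num)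
  let c : Sphere (m + 1) → ℝ := fun z => min 1 (1 - (z : EuclideanSpace ℝ (Fin (m + 1 + 1))) 0)
  have hc : Continuous c := by fun_prop
  have hc0 : ∀ z, 0 ≤ c z := fun z =>
    le_min zero_le_one (sub_nonneg.2 (abs_le.1 (Sphere.abs_coord_le z 0)).2)
  have hc1 : ∀ z, c z ≤ 1 := fun z => min_le_left _ _
  let u : C((I × Sphere m) × Sphere (m + 1), EuclideanSpace ℝ (Fin (m + 1 + 1))) :=
    ⟨fun y => (y.2 : EuclideanSpace ℝ (Fin (m + 1 + 1))) +
      ((y.1.1 : ℝ) * c y.2) • (p y.1.2 - F y.1.2), by fun_prop⟩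
  have hsm : ∀ y : (I × Sphere m) × Sphere (m + 1),
      ‖((y.1.1 : ℝ) * c y.2) • (p y.1.2 - F y.1.2)‖ < 1 / 4 := fun y => by
    rw [norm_smul, Real.norm_eq_abs, abs_of_nonneg (mul_nonneg y.1.1.2.1 (hc0 _))]
    exact (mul_le_of_le_one_left (norm_nonneg _)
      (mul_le_one₀ y.1.1.2.2 (hc0 _) (hc1 _))).trans_lt (hpF _)
  have hn : ∀ y, 3 / 4 < ‖u y‖ := fun y => by
    have h1 := norm_sub_le (u y) (((y.1.1 : ℝ) * c y.2) • (p y.1.2 - F y.1.2))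
    have h2 : u y - ((y.1.1 : ℝ) * c y.2) • (p y.1.2 - F y.1.2) = y.2 := add_sub_cancel_right _ _
    rw [h2, Sphere.norm_coe] at h1
    linarith [hsm y]
  have hu : ∀ y, u y ≠ 0 := fun y => norm_pos_iff.1 (by linarith [hn y])
  let T := normalizeMap u hu
  have hT : ∀ s, T (s, spherePt (m + 1)) = spherePt (m + 1) := fun s =>
    normalizeMap_eq _ _ (by
      have : c (spherePt (m + 1)) = 0 := by simp [c, Sphere.spherePt_zero]
      simp [u, this])
  let H : C(I × Sphere m, Bouquet ι (m + 1)) := (Bouquet.mapFamily T hT).comp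
    ((ContinuousMap.id _).prodMk (f.comp ContinuousMap.snd))
  let g : C(Sphere m, Bouquet ι (m + 1)) := H.comp ((ContinuousMap.const _ 1).prodMk (.id _))
  have h1 : f.Homotopic g := ⟨⟨H, fun x => Bouquet.mapFamily_eq_self T hT
    (normalizeMap_eq _ _ (by simp [u])), fun x => rfl⟩⟩
  refine h1.trans (homotopic_base_of_fold_gt g fun x => ?_)
  refine lt_of_le_of_ne (abs_le.1 (Sphere.abs_coord_le _ 0)).1 fun h => ?_
  have hz := Sphere.eq_neg_spherePt _ h.symm
  have hg : Bouquet.fold (g x) = T (((1 : I), x), Bouquet.fold (f x)) :=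
    Bouquet.fold_mapFamily T hT _ _
  set y : (I × Sphere m) × Sphere (m + 1) := (((1 : I), x), Bouquet.fold (f x)) with hy
  rw [hg, normalizeMap_coe, inv_smul_eq_iff₀ (norm_ne_zero_iff.2 (hu _))] at hz
  rcases le_or_gt ((Bouquet.fold (f x) : EuclideanSpace ℝ (Fin (m + 1 + 1))) 0) 0 with h0 | h0
  · have : c (Bouquet.fold (f x)) = 1 := min_eq_left (by linarith)
    have h2 : u y = p x := by simp [u, hy, this, F]
    rw [h2, smul_neg, ← neg_smul] at hz
    exact hp _ _ hz
  · have h2 := congrArg (fun w : EuclideanSpace ℝ (Fin (m + 1 + 1)) => w 0) hz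
    simp only [PiLp.smul_apply, PiLp.neg_apply, Sphere.spherePt_zero, smul_eq_mul] at h2
    have h3 : u y 0 = (Bouquet.fold (f x) : EuclideanSpace ℝ (Fin (m + 1 + 1))) 0 +
      (((y.1.1 : ℝ) * c y.2) • (p y.1.2 - F y.1.2)) 0 := rfl
    have h4 := (Sphere.abs_apply_le (((y.1.1 : ℝ) * c y.2) • (p y.1.2 - F y.1.2)) 0).trans
      (hsm y).le
    linarith [(abs_le.1 h4).1, hn y]

/-- A freely nullhomotopic map of a sphere is nullhomotopic relative to the base point. -/
theorem Sphere.homotopicRel_const {m : ℕ} {Y : Type*} [TopologicalSpace Y] {f : C(Sphere m, Y)}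
    {y : Y} (hf : f.Homotopic (.const _ y)) :
    f.HomotopicRel (.const _ (f (spherePt m))) {spherePt m} := by
  obtain ⟨H⟩ := hf
  let D := Metric.closedBall (0 : EuclideanSpace ℝ (Fin (m + 1))) 1
  let q : C(I × Sphere m, D) := ⟨fun x => ⟨(1 - (x.1 : ℝ)) • (x.2 : EuclideanSpace ℝ (Fin (m + 1))), by
    have := x.1.2.1
    have := x.1.2.2
    rw [mem_closedBall_zero_iff, norm_smul, Sphere.norm_coe, Real.norm_eq_abs, mul_one, abs_le]
    constructor <;> linarith⟩, by fun_prop⟩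
  have hqs : Surjective q := by
    rintro ⟨z, hz⟩
    rw [mem_closedBall_zero_iff] at hz
    by_cases h0 : z = 0
    · exact ⟨(1, spherePt m), Subtype.ext (by simp [q, h0])⟩
    · refine ⟨(⟨1 - ‖z‖, by linarith, by linarith [norm_nonneg z]⟩,
        ⟨‖z‖⁻¹ • z, by simp [norm_smul, h0]⟩), Subtype.ext ?_⟩
      simp [q, smul_smul, h0]
  have hq : Topology.IsQuotientMap q :=
    Topology.IsQuotientMap.of_surjective_continuous hqs q.continuous
  have hH : ∀ a b, q a = q b → H a = H b := by
    rintro ⟨s, a⟩ ⟨t, b⟩ h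
    have h' : (1 - (s : ℝ)) • (a : EuclideanSpace ℝ (Fin (m + 1))) =
      (1 - (t : ℝ)) • (b : EuclideanSpace ℝ (Fin (m + 1))) := congrArg Subtype.val h
    have h1 := congrArg norm h'
    rw [norm_smul, norm_smul, Sphere.norm_coe, Sphere.norm_coe, Real.norm_eq_abs, Real.norm_eq_abs,
      abs_of_nonneg (sub_nonneg.2 s.2.2), abs_of_nonneg (sub_nonneg.2 t.2.2)] at h1
    have hst : s = t := Subtype.ext (by linarith)
    subst hst
    by_cases hs : s = 1
    · subst hs
      rw [H.apply_one, H.apply_one]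
      rfl
    · have : (1 - (s : ℝ)) ≠ 0 := fun h => hs (Subtype.ext (by
        rw [Set.Icc.coe_one]; linarith))
      rw [Subtype.ext (smul_right_injective _ this h')]
  let G : C(D, Y) := hq.lift H.toContinuousMap hH
  have hG : ∀ a, G (q a) = H a := fun a => DFunLike.congr_fun (hq.lift_comp H.toContinuousMap hH) a
  have hGS : ∀ x : Sphere m, ∀ d : D, d.1 = x → G d = f x := fun x d hd => by
    rw [← H.apply_zero, ← hG]
    congr 1
    exact Subtype.ext (by simp [q, hd])
  let K : C(I × Sphere m, D) := ⟨fun x => ⟨(1 - (x.1 : ℝ)) • (x.2 : EuclideanSpace ℝ (Fin (m + 1)))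
    + (x.1 : ℝ) • (spherePt m : EuclideanSpace ℝ (Fin (m + 1))),
    convex_closedBall _ _ (Metric.sphere_subset_closedBall x.2.2)
      (Metric.sphere_subset_closedBall (spherePt m).2) (sub_nonneg.2 x.1.2.2) x.1.2.1 (by ring)⟩,
    by fun_prop⟩
  refine ⟨⟨⟨G.comp K, fun x => hGS _ _ (by simp [K]), fun x => ?_⟩, ?_⟩⟩
  · exact hGS _ _ (by simp [K])
  · rintro t x rfl
    exact hGS _ _ (by simp only [K, ContinuousMap.coe_mk, ← add_smul]; simp)

theorem Bouquet.joined_base {ι : Type} {n : ℕ} (b : Bouquet ι (n + 1)) : Joined b base := by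
  rcases b.cases_on with rfl | ⟨i, z, rfl⟩
  · exact Joined.refl _
  · have h : IsPathConnected (Metric.sphere (0 : EuclideanSpace ℝ (Fin (n + 1 + 1))) 1) :=
      isPathConnected_sphere (by
        rw [← Module.finrank_eq_rank, finrank_euclideanSpace, Fintype.card_fin]
        exact_mod_cast (by omega : 1 < n + 1 + 1)) 0 zero_le_one
    have := isPathConnected_iff_pathConnectedSpace.1 h
    rw [← inSphere_spherePt i]
    exact ⟨(PathConnectedSpace.somePath z (spherePt (n + 1))).map (continuous_inSphere i)⟩

theorem Bouquet.homotopic_const_base {ι κ : Type} {m : ℕ}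
    (g : C(Bouquet κ m, Bouquet ι (m + 1))) : g.Homotopic (.const _ base) := by
  have h1 : g.Homotopic (.const _ (g base)) := by
    have : ∀ i : κ, ((g.comp ⟨_, continuous_inSphere i⟩).HomotopicRel
        (.const _ (g.comp ⟨_, continuous_inSphere i⟩ (spherePt m))) {spherePt m}) := fun i =>
      Sphere.homotopicRel_const (sphere_to_bouquet_homotopic_base _)
    have K := fun i => (this i).some
    have hK : ∀ i t, K i (t, spherePt m) = g base := fun i t =>
      ((K i).eq_fst t rfl).trans (congrArg g (inSphere_spherePt i))
    refine ⟨⟨⟨fun x => lift (g base) (fun i z => K i (x.1, z)) (fun i => hK i x.1) x.2,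
      continuous_prod continuous_const fun i => (K i).continuous⟩, fun b => ?_, fun b => ?_⟩⟩
    · rcases b.cases_on with rfl | ⟨i, z, rfl⟩
      · rfl
      · exact (K i).apply_zero z
    · rcases b.cases_on with rfl | ⟨i, z, rfl⟩
      · rfl
      · exact ((K i).apply_one z).trans (congrArg g (inSphere_spherePt i))
  obtain ⟨γ⟩ := (g base).joined_base
  exact h1.trans ⟨⟨⟨fun x => γ x.1, by fun_prop⟩, fun _ => γ.source, fun _ => γ.target⟩⟩

theorem ContinuousMap.HomotopicRel.of_continuous {X Y : Type*} [TopologicalSpace X]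
    [TopologicalSpace Y] {f g : C(X, Y)} {S : Set X} (H : I × X → Y) (hH : Continuous H)
    (h0 : ∀ x, H (0, x) = f x) (h1 : ∀ x, H (1, x) = g x) (hS : ∀ s, ∀ x ∈ S, H (s, x) = f x) :
    f.HomotopicRel g S :=
  ⟨⟨⟨⟨H, hH⟩, h0, h1⟩, hS⟩⟩

theorem ContinuousMap.HomotopicRel.precomp {X Y Z : Type*} [TopologicalSpace X]
    [TopologicalSpace Y] [TopologicalSpace Z] {f g : C(Y, Z)} {S : Set Y} {T : Set X}
    (h : f.HomotopicRel g S) (k : C(X, Y)) (hk : ∀ x ∈ T, k x ∈ S) :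
    (f.comp k).HomotopicRel (g.comp k) T := by
  obtain ⟨H⟩ := h
  exact .of_continuous (fun x => H (x.1, k x.2)) (by fun_prop) (fun x => H.apply_zero _)
    (fun x => H.apply_one _) fun s x hx => H.eq_fst s (hk x hx)

/-- Pointed homotopy equivalence of pointed spaces. -/
def PointedEquiv {X Y : Type*} [TopologicalSpace X] [TopologicalSpace Y] (x₀ : X) (y₀ : Y) :
    Prop :=
  ∃ (f : C(X, Y)) (g : C(Y, X)), f x₀ = y₀ ∧ g y₀ = x₀ ∧
    (g.comp f).HomotopicRel (.id X) {x₀} ∧ (f.comp g).HomotopicRel (.id Y) {y₀}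

namespace PointedEquiv

variable {X Y Z : Type*} [TopologicalSpace X] [TopologicalSpace Y] [TopologicalSpace Z]
  {x : X} {y : Y} {z : Z}

theorem symm (h : PointedEquiv x y) : PointedEquiv y x := by
  obtain ⟨f, g, hf, hg, h1, h2⟩ := h
  exact ⟨g, f, hg, hf, h2, h1⟩

theorem trans (h : PointedEquiv x y) (h' : PointedEquiv y z) : PointedEquiv x z := by
  obtain ⟨f, g, hf, hg, h1, h2⟩ := h
  obtain ⟨f', g', hf', hg', h1', h2'⟩ := h'
  refine ⟨f'.comp f, g.comp g', by simp [hf, hf'], by simp [hg, hg'], ?_, ?_⟩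
  · refine HomotopicRel.trans ?_ h1
    exact (h1'.comp_continuousMap g).precomp f (T := {x}) (by simpa using hf)
  · refine HomotopicRel.trans ?_ h2'
    exact (h2.comp_continuousMap f').precomp g' (T := {z}) (by simpa using hg')

theorem nonempty_homotopyEquiv (h : PointedEquiv x y) :
    Nonempty (ContinuousMap.HomotopyEquiv X Y) := by
  obtain ⟨f, g, hf, hg, ⟨h1⟩, ⟨h2⟩⟩ := h
  exact ⟨⟨f, g, ⟨h1.toHomotopy⟩, ⟨h2.toHomotopy⟩⟩⟩

end PointedEquiv

/-- The relation gluing cones to a space. -/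
inductive ConesRel {W : Type} {L : W → Type} {X : Type} (φ : ∀ w, L w → X) :
    X ⊕ ((Σ w, L w × I) ⊕ (Σ _ : W, Unit)) → X ⊕ ((Σ w, L w × I) ⊕ (Σ _ : W, Unit)) → Prop
  | bot (w : W) (c : L w) : ConesRel φ (Sum.inr (Sum.inl ⟨w, c, 0⟩)) (Sum.inl (φ w c))
  | top (w : W) (c : L w) : ConesRel φ (Sum.inr (Sum.inl ⟨w, c, 1⟩)) (Sum.inr (Sum.inr ⟨w, ()⟩))

/-- The space obtained from `X` by attaching a cone along each of the maps `φ w : L w → X`. -/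
def Cones {W : Type} {L : W → Type} {X : Type} [TopologicalSpace X]
    [∀ w, TopologicalSpace (L w)] (φ : ∀ w, C(L w, X)) : Type :=
  Quot (ConesRel fun w => φ w)

namespace Cones

variable {W : Type} {L : W → Type} {X : Type} [TopologicalSpace X] [∀ w, TopologicalSpace (L w)]
  {φ : ∀ w, C(L w, X)}

instance : TopologicalSpace (Cones φ) := inferInstanceAs (TopologicalSpace (Quot _))

/-- The inclusion of the base space. -/
def inX (x : X) : Cones φ := Quot.mk _ (Sum.inl x)

/-- The characteristic map of a cone. -/
def inC (w : W) (x : L w × I) : Cones φ := Quot.mk _ (Sum.inr (Sum.inl ⟨w, x⟩))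

/-- The apex of a cone. -/
def apex (w : W) : Cones φ := Quot.mk _ (Sum.inr (Sum.inr ⟨w, ()⟩))

theorem inC_zero (w : W) (c : L w) : (inC w (c, 0) : Cones φ) = inX (φ w c) :=
  Quot.sound (.bot w c)

theorem inC_one (w : W) (c : L w) : (inC w (c, 1) : Cones φ) = apex w :=
  Quot.sound (.top w c)

theorem cases_on (b : Cones φ) :
    (∃ x, b = inX x) ∨ (∃ w c t, b = inC w (c, t)) ∨ ∃ w, b = apex w := by
  rcases b with ⟨x | ⟨w, c, t⟩ | ⟨w, ⟨⟩⟩⟩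
  · exact Or.inl ⟨x, rfl⟩
  · exact Or.inr (Or.inl ⟨w, c, t, rfl⟩)
  · exact Or.inr (Or.inr ⟨w, rfl⟩)

theorem isQuotientMap_mk : Topology.IsQuotientMap (Quot.mk _ : _ → Cones φ) :=
  isQuotientMap_quot_mk

theorem continuous_prod {P Y : Type*} [TopologicalSpace P] [LocallyCompactSpace P]
    [TopologicalSpace Y] {F : P × Cones φ → Y} (hX : Continuous fun x : P × X => F (x.1, inX x.2))
    (hC : ∀ w, Continuous fun x : P × (L w × I) => F (x.1, inC w x.2))
    (hp : ∀ w, Continuous fun p => F (p, apex w)) : Continuous F :=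
  isQuotientMap_mk.continuous_lift_prod_right
    (continuous_prod_sum hX (continuous_prod_sum (continuous_prod_sigma hC)
      (continuous_prod_sigma fun w => (hp w).comp continuous_fst)))

theorem continuous_of {Y : Type*} [TopologicalSpace Y] {F : Cones φ → Y}
    (hX : Continuous fun x => F (inX x)) (hC : ∀ w, Continuous fun x => F (inC w x)) :
    Continuous F :=
  isQuotientMap_mk.continuous_iff.2 (continuous_sum_dom.2 ⟨hX, continuous_sum_dom.2
    ⟨continuous_sigma hC, continuous_sigma fun _ => continuous_of_const fun _ _ => rfl⟩⟩)

@[fun_prop] theorem continuous_inX : Continuous (inX : X → Cones φ) :=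
  isQuotientMap_mk.continuous.comp continuous_inl

@[fun_prop] theorem continuous_inC (w : W) : Continuous (inC w : _ → Cones φ) :=
  isQuotientMap_mk.continuous.comp (continuous_inr.comp (continuous_inl.comp continuous_sigmaMk))

/-- The map out of an attachment of cones given by its restrictions to the pieces. -/
def lift {Y : Type*} (a : X → Y) (b : ∀ w, L w × I → Y) (p : W → Y)
    (h0 : ∀ w c, b w (c, 0) = a (φ w c)) (h1 : ∀ w c, b w (c, 1) = p w) : Cones φ → Y :=
  Quot.lift (Sum.elim a (Sum.elim (fun x => b x.1 x.2) fun x => p x.1)) (by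
    rintro _ _ (⟨w, c⟩ | ⟨w, c⟩)
    · exact h0 w c
    · exact h1 w c)

section lift

variable {Y : Type*} (a : X → Y) (b : ∀ w, L w × I → Y) (p : W → Y)
    (h0 : ∀ w c, b w (c, 0) = a (φ w c)) (h1 : ∀ w c, b w (c, 1) = p w)

@[simp] theorem lift_inX (x : X) : lift a b p h0 h1 (inX x) = a x := rfl
@[simp] theorem lift_inC (w : W) (x : L w × I) : lift a b p h0 h1 (inC w x) = b w x := rfl
@[simp] theorem lift_apex (w : W) : lift a b p h0 h1 (apex w) = p w := rfl

end lift

/-- The characteristic map of a cone, with the cone parameter clamped to the unit interval. -/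
noncomputable def inCone (w : W) (c : L w) (r : ℝ) : Cones φ :=
  inC w (c, projIcc 0 1 zero_le_one r)

theorem inCone_of_le {w : W} {c : L w} {r : ℝ} (h : r ≤ 0) :
    (inCone w c r : Cones φ) = inX (φ w c) := by
  rw [inCone, projIcc_of_le_left _ h]
  exact inC_zero w c

theorem inCone_of_ge {w : W} {c : L w} {r : ℝ} (h : 1 ≤ r) :
    (inCone w c r : Cones φ) = apex w := by
  rw [inCone, projIcc_of_right_le _ h]
  exact inC_one w c

theorem inCone_coe (w : W) (c : L w) (t : I) : (inCone w c t : Cones φ) = inC w (c, t) := by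
  rw [inCone, projIcc_val]

theorem continuous_inCone (w : W) :
    Continuous fun x : L w × ℝ => (inCone w x.1 x.2 : Cones φ) :=
  (continuous_inC w).comp (continuous_fst.prodMk (continuous_projIcc.comp continuous_snd))

@[fun_prop] theorem _root_.Continuous.inCone {P : Type*} [TopologicalSpace P] {w : W}
    {c : P → L w} {r : P → ℝ} (hc : Continuous c) (hr : Continuous r) :
    Continuous fun p => (inCone w (c p) (r p) : Cones φ) :=
  (continuous_inCone w).comp (hc.prodMk hr)

/-- A self-map of an attachment of cones that only reparametrizes the cones is homotopic to the
identity. -/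
theorem homotopicRel_id_of_reparam (F : C(Cones φ, Cones φ)) (r : ℝ → ℝ) (hr : Continuous r)
    (h0 : r 0 ≤ 0) (h1 : 1 ≤ r 1) (hX : ∀ x, F (inX x) = inX x)
    (hC : ∀ w c (t : I), F (inC w (c, t)) = inCone w c (r t)) (hp : ∀ w, F (apex w) = apex w) :
    F.HomotopicRel (.id _) (range inX) := by
  refine .of_continuous (fun y => lift inX (fun w x => inCone w x.1
    ((1 - (y.1 : ℝ)) * r x.2 + (y.1 : ℝ) * x.2)) apex (fun w c => ?_) (fun w c => ?_) y.2)
    (continuous_prod ?_ (fun w => ?_) fun w => ?_) (fun b => ?_) (fun b => ?_) ?_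
  · refine inCone_of_le ?_
    have := mul_nonneg (sub_nonneg.2 y.1.2.2) (neg_nonneg.2 h0)
    simp only [Icc.coe_zero]
    linarith
  · refine inCone_of_ge ?_
    have := mul_nonneg (sub_nonneg.2 y.1.2.2) (sub_nonneg.2 h1)
    simp only [Icc.coe_one]
    linarith
  · simp only [lift_inX]
    fun_prop
  · simp only [lift_inC]
    fun_prop
  · simp only [lift_apex]
    fun_prop
  · rcases b.cases_on with ⟨x, rfl⟩ | ⟨w, c, t, rfl⟩ | ⟨w, rfl⟩
    · simp [hX]
    · simp [hC]
    · simp [hp]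
  · rcases b.cases_on with ⟨x, rfl⟩ | ⟨w, c, t, rfl⟩ | ⟨w, rfl⟩
    · simp
    · simp [inCone_coe]
    · simp
  · rintro s _ ⟨x, rfl⟩
    simp [hX]

section Homotopy

variable {ψ : ∀ w, C(L w, X)}

/-- A homotopy of attaching maps extended by the cones. -/
noncomputable def cylinder (H : ∀ w, (φ w).Homotopy (ψ w)) (w : W) (c : L w) (r : ℝ) : Cones ψ :=
  if r ≤ 0 then inX (H w (projIcc 0 1 zero_le_one (r + 1), c)) else inCone w c r

theorem continuous_cylinder (H : ∀ w, (φ w).Homotopy (ψ w)) (w : W) :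
    Continuous fun x : L w × ℝ => cylinder H w x.1 x.2 := by
  refine Continuous.if_le ?_ ?_ continuous_snd continuous_const ?_
  · have := continuous_projIcc (a := (0 : ℝ)) (b := 1) (h := zero_le_one)
    fun_prop
  · fun_prop
  · rintro ⟨c, r⟩ (rfl : r = 0)
    simp only
    rw [inCone_of_le le_rfl, zero_add, projIcc_of_right_le _ le_rfl]
    exact congrArg inX ((H w).apply_one c)

/-- The map between attachments of cones along homotopic maps. -/
noncomputable def ofHomotopy (H : ∀ w, (φ w).Homotopy (ψ w)) : C(Cones φ, Cones ψ) where
  toFun := lift inX (fun w x => cylinder H w x.1 (2 * x.2 - 1)) apex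
    (fun w c => by
      simp only [cylinder, Icc.coe_zero]
      rw [if_pos (by norm_num), projIcc_of_le_left _ (by norm_num)]
      exact congrArg inX ((H w).apply_zero c))
    (fun w c => by
      simp only [cylinder, Icc.coe_one]
      rw [if_neg (by norm_num), inCone_of_ge (by norm_num)])
  continuous_toFun := continuous_of continuous_inX fun w => by
    simp only [lift_inC]
    exact (continuous_cylinder H w).comp
      (by fun_prop : Continuous fun x : L w × I => (x.1, 2 * (x.2 : ℝ) - 1))

theorem ofHomotopy_comp (H : ∀ w, (φ w).Homotopy (ψ w)) :
    ((ofHomotopy fun w => (H w).symm).comp (ofHomotopy H)).HomotopicRel (.id _) (range inX) := by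
  let τ : ℝ → ℝ := fun t => min (2 * t) (3 - 4 * t)
  have hτ : Continuous τ := by fun_prop
  let Θ : ∀ w, I × (L w × I) → Cones φ := fun w y =>
    if (y.2.2 : ℝ) ≤ 3 / 4 then
      inX (H w (projIcc 0 1 zero_le_one (min (1 - (y.1 : ℝ)) (τ y.2.2)), y.2.1))
    else inCone w y.2.1 (4 * y.2.2 - 3)
  have hΘ : ∀ w, Continuous (Θ w) := fun w => by
    refine Continuous.if_le ?_ ?_ (by fun_prop) continuous_const ?_
    · have := continuous_projIcc (a := (0 : ℝ)) (b := 1) (h := zero_le_one)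
      fun_prop
    · fun_prop
    · rintro ⟨s, c, t⟩ (h : (t : ℝ) = 3 / 4)
      simp only
      rw [inCone_of_le (by linarith), projIcc_of_le_left]
      · exact congrArg inX ((H w).apply_zero c)
      · refine (min_le_right _ _).trans ((min_le_right _ _).trans ?_)
        linarith
  let F' : C(Cones φ, Cones φ) := ⟨lift inX (fun w x => inCone w x.1 (4 * x.2 - 3)) apex
    (fun w c => inCone_of_le (by simp)) (fun w c => inCone_of_ge (by norm_num)),
    continuous_of continuous_inX fun w => by simp only [lift_inC]; fun_prop⟩
  have h1 : ((ofHomotopy fun w => (H w).symm).comp (ofHomotopy H)).HomotopicRel F' (range inX) := by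
    refine .of_continuous (fun y => lift inX (fun w x => Θ w (y.1, x)) apex
      (fun w c => ?_) (fun w c => ?_) y.2)
      (continuous_prod ?_ (fun w => hΘ w) fun w => ?_) (fun b => ?_) (fun b => ?_) ?_
    · simp only [Θ]
      rw [if_pos (by norm_num), projIcc_of_le_left]
      · exact congrArg inX ((H w).apply_zero c)
      · simp [τ]
    · simp only [Θ]
      rw [if_neg (by norm_num), inCone_of_ge (by norm_num)]
    · simp only [lift_inX]
      fun_prop
    · simp only [lift_apex]
      fun_prop
    · rcases b.cases_on with ⟨x, rfl⟩ | ⟨w, c, t, rfl⟩ | ⟨w, rfl⟩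
      · rfl
      · have ht0 := t.2.1
        have ht1 := t.2.2
        have e1 : ofHomotopy H (inC w (c, t)) = cylinder H w c (2 * t - 1) := rfl
        have e2 : ∀ r : ℝ, 0 ≤ r → r ≤ 1 → ofHomotopy (fun w => (H w).symm) (inCone w c r) =
            cylinder (fun w => (H w).symm) w c (2 * r - 1) := fun r h0 h1 => by
          lift r to I using ⟨h0, h1⟩
          rw [inCone_coe]
          rfl
        rw [ContinuousMap.comp_apply, e1, lift_inC, cylinder]
        simp only [Θ]
        split_ifs with h1 h2 h2
        · have e2 : ∀ x, ofHomotopy (fun w => (H w).symm) (inX x) = inX x := fun x => rfl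
          rw [e2, min_eq_right, sub_add_cancel]
          · simp only [τ]
            rw [min_eq_left (by linarith)]
          · simp only [τ, Icc.coe_zero]
            exact (min_le_left _ _).trans (by linarith)
        · rw [e2 _ (by linarith) (by linarith), cylinder, if_pos (by linarith),
            Homotopy.symm_apply, min_eq_right]
          · have e3 : ∀ r : ℝ, unitInterval.symm (projIcc 0 1 zero_le_one r) =
                projIcc 0 1 zero_le_one (1 - r) := unitInterval.symm_projIcc
            rw [e3]
            congr 4
            simp only [τ]
            rw [min_eq_right (by linarith)]
            ring
          · simp only [τ, Icc.coe_zero]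
            exact (min_le_right _ _).trans (by linarith)
        · exfalso; linarith
        · rw [e2 _ (by linarith) (by linarith), cylinder, if_neg (by linarith)]
          congr 1
          ring
      · rfl
    · rcases b.cases_on with ⟨x, rfl⟩ | ⟨w, c, t, rfl⟩ | ⟨w, rfl⟩
      · rfl
      · simp only [lift_inC, Θ, F', ContinuousMap.coe_mk]
        split_ifs with h
        · rw [inCone_of_le (by linarith), projIcc_of_le_left]
          · exact congrArg inX ((H w).apply_zero c)
          · simp
        · rfl
      · rfl
    · rintro s _ ⟨x, rfl⟩
      rfl
  refine h1.trans (homotopicRel_id_of_reparam F' (fun t => 4 * t - 3) (by fun_prop) (by norm_num)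
    (by norm_num) (fun x => rfl) (fun w c t => rfl) fun w => rfl)

theorem pointedEquiv_of_homotopy (H : ∀ w, (φ w).Homotopic (ψ w)) (x : X) :
    PointedEquiv (inX x : Cones φ) (inX x : Cones ψ) := by
  have K := fun w => (H w).some
  have mono : ∀ {φ : ∀ w, C(L w, X)} {f g : C(Cones φ, Cones φ)},
      f.HomotopicRel g (range inX) → f.HomotopicRel g {inX x} := fun h =>
    h.precomp (.id _) (by rintro _ rfl; exact mem_range_self x)
  refine ⟨ofHomotopy K, ofHomotopy fun w => (K w).symm, rfl, rfl, mono (ofHomotopy_comp K), ?_⟩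
  convert mono (ofHomotopy_comp fun w => (K w).symm) using 2
  simp

end Homotopy

section Const

variable {Y : Type} {M : W → Type} [TopologicalSpace Y] [∀ w, TopologicalSpace (M w)]

/-- Functoriality of the attachment of cones along constant maps. -/
def mapConst {x : X} {y : Y} (f : C(X, Y)) (hf : f x = y) (l : ∀ w, C(L w, M w)) :
    C(Cones (fun w => ContinuousMap.const (L w) x), Cones fun w => ContinuousMap.const (M w) y) where
  toFun := lift (fun a => inX (f a)) (fun w a => inC w (l w a.1, a.2)) apex
    (fun w c => by
      rw [inC_zero, ContinuousMap.const_apply, ContinuousMap.const_apply, hf]) fun w c => inC_one w _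
  continuous_toFun := continuous_of (by simp only [lift_inX]; fun_prop) fun w => by
    simp only [lift_inC]; fun_prop

theorem mapConst_homotopicRel {x : X} (f : C(X, X)) (hf : f x = x) (l : ∀ w, C(L w, L w))
    (h : f.HomotopicRel (.id X) {x}) (hl : ∀ w, (l w).Homotopic (.id _)) :
    (mapConst f hf l).HomotopicRel (.id _) {inX x} := by
  obtain ⟨H⟩ := h
  have K := fun w => (hl w).some
  refine .of_continuous (fun y => lift (fun a => inX (H (y.1, a)))
    (fun w a => inC w (K w (y.1, a.1), a.2)) apex (fun w c => ?_) (fun w c => inC_one w _) y.2)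
    (continuous_prod ?_ (fun w => ?_) fun w => ?_) (fun b => ?_) (fun b => ?_) ?_
  · simp only [inC_zero, ContinuousMap.const_apply]
    exact congrArg inX (H.eq_snd _ rfl).symm
  · exact continuous_inX.comp H.continuous
  · simp only [lift_inC]
    fun_prop
  · simp only [lift_apex]
    fun_prop
  · rcases b.cases_on with ⟨x, rfl⟩ | ⟨w, c, t, rfl⟩ | ⟨w, rfl⟩
    · simp [mapConst]
    · simp [mapConst]
    · rfl
  · rcases b.cases_on with ⟨x, rfl⟩ | ⟨w, c, t, rfl⟩ | ⟨w, rfl⟩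
    · simp
    · simp
    · rfl
  · rintro s _ rfl
    simp only [lift_inX]
    rw [H.eq_fst _ rfl]
    rfl

theorem pointedEquiv_const {x : X} {y : Y} (h : PointedEquiv x y)
    (hl : ∀ w, Nonempty (ContinuousMap.HomotopyEquiv (L w) (M w))) :
    PointedEquiv (inX x : Cones (fun w => ContinuousMap.const (L w) x))
      (inX y : Cones fun w => ContinuousMap.const (M w) y) := by
  obtain ⟨f, g, hf, hg, h1, h2⟩ := h
  have e := fun w => (hl w).some
  refine ⟨mapConst f hf fun w => (e w).toFun, mapConst g hg fun w => (e w).invFun,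
    congrArg inX hf, congrArg inX hg, ?_, ?_⟩
  · convert mapConst_homotopicRel (g.comp f) (by simp [hf, hg]) _ h1 fun w => (e w).left_inv
    ext b
    rcases b.cases_on with ⟨x, rfl⟩ | ⟨w, c, t, rfl⟩ | ⟨w, rfl⟩ <;> rfl
  · convert mapConst_homotopicRel (f.comp g) (by simp [hf, hg]) _ h2 fun w => (e w).right_inv
    ext b
    rcases b.cases_on with ⟨x, rfl⟩ | ⟨w, c, t, rfl⟩ | ⟨w, rfl⟩ <;> rfl

end Const

end Cones

namespace Sphere

variable {m : ℕ}

theorem sum_sq (z : Sphere m) : ∑ i, (z : EuclideanSpace ℝ (Fin (m + 1))) i ^ 2 = 1 := by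
  have := EuclideanSpace.real_norm_sq_eq (z : EuclideanSpace ℝ (Fin (m + 1)))
  rw [norm_coe, one_pow] at this
  exact this.symm

theorem mem_of_sum_sq {z : EuclideanSpace ℝ (Fin (m + 1))} (h : ∑ i, z i ^ 2 = 1) :
    z ∈ Metric.sphere (0 : EuclideanSpace ℝ (Fin (m + 1))) 1 := by
  rw [mem_sphere_zero_iff_norm, ← sq_eq_sq₀ (norm_nonneg _) zero_le_one,
    EuclideanSpace.real_norm_sq_eq, h, one_pow]

theorem ext_coord {z z' : Sphere m} (h : ∀ i, (z : EuclideanSpace ℝ (Fin (m + 1))) i =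
    (z' : EuclideanSpace ℝ (Fin (m + 1))) i) : z = z' :=
  Subtype.ext (PiLp.ext h)

theorem continuous_of_coord {P : Type*} [TopologicalSpace P] {f : P → Sphere m}
    (h : ∀ i, Continuous fun p => (f p : EuclideanSpace ℝ (Fin (m + 1))) i) : Continuous f := by
  refine Continuous.subtype_mk (f := fun p => (f p : EuclideanSpace ℝ (Fin (m + 1)))) ?_ _
  exact (PiLp.continuous_toLp 2 _).comp (continuous_pi h)

theorem spherePt_succ (i : Fin m) :
    (spherePt m : EuclideanSpace ℝ (Fin (m + 1))) i.succ = 0 := by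
  simp [spherePt_coe]

/-- The parametrization of the `(m+1)`-sphere as the suspension of the `m`-sphere. -/
noncomputable def susp : C(Sphere m × I, Sphere (m + 1)) where
  toFun x := ⟨WithLp.toLp 2 (Fin.cons (Real.cos (Real.pi * x.2)) fun i =>
      Real.sin (Real.pi * x.2) * (x.1 : EuclideanSpace ℝ (Fin (m + 1))) i), mem_of_sum_sq (by
    rw [Fin.sum_univ_succ]
    simp only [Fin.cons_zero, Fin.cons_succ, mul_pow, ← Finset.mul_sum, sum_sq]
    rw [mul_one, Real.cos_sq_add_sin_sq])⟩
  continuous_toFun := continuous_of_coord fun i => by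
    refine Fin.cases ?_ (fun j => ?_) i
    · simp only [Fin.cons_zero]
      fun_prop
    · simp only [Fin.cons_succ]
      fun_prop

@[simp] theorem susp_coord_zero (x : Sphere m × I) :
    (susp x : EuclideanSpace ℝ (Fin (m + 1 + 1))) 0 = Real.cos (Real.pi * x.2) := rfl

@[simp] theorem susp_coord_succ (x : Sphere m × I) (i : Fin (m + 1)) :
    (susp x : EuclideanSpace ℝ (Fin (m + 1 + 1))) i.succ =
      Real.sin (Real.pi * x.2) * (x.1 : EuclideanSpace ℝ (Fin (m + 1))) i := rfl

theorem susp_zero (y : Sphere m) : susp (y, 0) = spherePt (m + 1) := by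
  refine ext_coord fun i => Fin.cases ?_ (fun j => ?_) i
  · simp [spherePt_zero]
  · simp [spherePt_succ]

theorem susp_one (y y' : Sphere m) : susp (y, 1) = susp (y', 1) := by
  refine ext_coord fun i => Fin.cases ?_ (fun j => ?_) i
  · simp
  · simp

theorem susp_surjective : Surjective (susp (m := m)) := by
  intro z
  set z0 := (z : EuclideanSpace ℝ (Fin (m + 1 + 1))) 0 with hz0
  have hb := abs_le.1 (abs_coord_le z 0)
  have hpi := Real.pi_pos
  let t : I := ⟨Real.arccos z0 / Real.pi, div_nonneg (Real.arccos_nonneg _) hpi.le,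
    (div_le_one hpi).2 (Real.arccos_le_pi _)⟩
  have ht : Real.pi * t = Real.arccos z0 := mul_div_cancel₀ _ hpi.ne'
  have hs := sum_sq z
  rw [Fin.sum_univ_succ, ← hz0] at hs
  have hcos : Real.cos (Real.pi * t) = z0 := by rw [ht, Real.cos_arccos hb.1 hb.2]
  have hsin := Real.sin_sq_add_cos_sq (Real.pi * t)
  rw [hcos] at hsin
  by_cases h0 : Real.sin (Real.pi * t) = 0
  · refine ⟨(spherePt m, t), ext_coord fun i => Fin.cases hcos (fun j => ?_) i⟩
    rw [susp_coord_succ, h0, zero_mul]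
    rw [h0] at hsin
    have h1 : ∑ j : Fin (m + 1), (z : EuclideanSpace ℝ (Fin (m + 1 + 1))) j.succ ^ 2 = 0 := by
      linarith
    have h2 := (Finset.sum_eq_zero_iff_of_nonneg fun j _ => sq_nonneg _).1 h1 j (Finset.mem_univ j)
    exact (pow_eq_zero_iff two_ne_zero |>.1 h2).symm
  · let y : Sphere m := ⟨WithLp.toLp 2 fun j => (Real.sin (Real.pi * t))⁻¹ *
      (z : EuclideanSpace ℝ (Fin (m + 1 + 1))) j.succ, mem_of_sum_sq (by
        simp only [mul_pow, ← Finset.mul_sum]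
        rw [show ∑ j : Fin (m + 1), (z : EuclideanSpace ℝ (Fin (m + 1 + 1))) j.succ ^ 2 =
          Real.sin (Real.pi * t) ^ 2 by linarith, inv_pow, inv_mul_cancel₀ (pow_ne_zero _ h0)])⟩
    refine ⟨(y, t), ext_coord fun i => Fin.cases hcos (fun j => ?_) i⟩
    rw [susp_coord_succ]
    exact mul_inv_cancel_left₀ h0 _

theorem susp_eq {y y' : Sphere m} {t t' : I} (h : susp (y, t) = susp (y', t')) :
    t = t' ∧ (y = y' ∨ t = 0 ∨ t = 1) := by
  have hpi := Real.pi_pos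
  have h' : ∀ i, (susp (y, t) : EuclideanSpace ℝ (Fin (m + 1 + 1))) i =
    (susp (y', t') : EuclideanSpace ℝ (Fin (m + 1 + 1))) i := fun i => by rw [h]
  have hmem : ∀ t : I, Real.pi * t ∈ Icc 0 Real.pi := fun t =>
    ⟨mul_nonneg hpi.le t.2.1, mul_le_of_le_one_right hpi.le t.2.2⟩
  have ht : t = t' := Subtype.ext
    (mul_left_cancel₀ hpi.ne' (Real.injOn_cos (hmem t) (hmem t') (h' 0)))
  subst ht
  refine ⟨rfl, ?_⟩
  by_cases h0 : Real.sin (Real.pi * t) = 0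
  · right
    by_contra! hne
    have h1 : (0 : ℝ) < t := lt_of_le_of_ne t.2.1 fun h => hne.1 (Subtype.ext h.symm)
    have h2 : (t : ℝ) < 1 := lt_of_le_of_ne t.2.2 fun h => hne.2 (Subtype.ext h)
    exact (Real.sin_pos_of_pos_of_lt_pi (mul_pos hpi h1) (by nlinarith)).ne' h0
  · left
    refine ext_coord fun i => mul_left_cancel₀ h0 (h' i.succ)

theorem isQuotientMap_susp : Topology.IsQuotientMap (susp (m := m)) :=
  Topology.IsQuotientMap.of_surjective_continuous susp_surjective susp.continuous

/-- The angle of the rotation bringing the meridian through the base point back to the pole. -/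
noncomputable def angle (s : I) (z : Sphere (m + 1)) : ℝ :=
  s * Real.arccos ((z : EuclideanSpace ℝ (Fin (m + 1 + 1))) 0)

/-- A homotopy of pointed self-maps of the sphere from the identity, contracting a meridian. -/
noncomputable def twist : C(I × Sphere (m + 1), Sphere (m + 1)) where
  toFun x := ⟨WithLp.toLp 2 (Fin.cons
      (Real.cos (angle x.1 x.2) * (x.2 : EuclideanSpace ℝ (Fin (m + 1 + 1))) 0 +
        Real.sin (angle x.1 x.2) * (x.2 : EuclideanSpace ℝ (Fin (m + 1 + 1))) 1)
      (Fin.cons (Real.cos (angle x.1 x.2) * (x.2 : EuclideanSpace ℝ (Fin (m + 1 + 1))) 1 -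
        Real.sin (angle x.1 x.2) * (x.2 : EuclideanSpace ℝ (Fin (m + 1 + 1))) 0)
        fun j => (x.2 : EuclideanSpace ℝ (Fin (m + 1 + 1))) j.succ.succ)), mem_of_sum_sq (by
      have h := sum_sq x.2
      rw [Fin.sum_univ_succ, Fin.sum_univ_succ] at h ⊢
      simp only [Fin.cons_zero, Fin.cons_succ]
      rw [Fin.succ_zero_eq_one] at h
      refine Eq.trans ?_ h
      linear_combination ((x.2 : EuclideanSpace ℝ (Fin (m + 1 + 1))) 0 ^ 2 +
        (x.2 : EuclideanSpace ℝ (Fin (m + 1 + 1))) 1 ^ 2) *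
        Real.cos_sq_add_sin_sq (angle x.1 x.2))⟩
  continuous_toFun := continuous_of_coord fun i => by
    have : Continuous fun x : I × Sphere (m + 1) => angle x.1 x.2 := by
      unfold angle
      fun_prop
    refine Fin.cases ?_ (fun j => Fin.cases ?_ (fun j => ?_) j) i
    · simp only [Fin.cons_zero]
      fun_prop
    · simp only [Fin.cons_succ, Fin.cons_zero]
      fun_prop
    · simp only [Fin.cons_succ]
      fun_prop

theorem twist_zero (z : Sphere (m + 1)) : twist (0, z) = z := by
  refine ext_coord fun i => Fin.cases ?_ (fun j => Fin.cases ?_ (fun j => ?_) j) i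
  · simp [twist, angle]
  · simp [twist, angle]
  · simp [twist]

theorem twist_susp (s t : I) : twist (s, susp (spherePt m, t)) =
    susp (spherePt m, unitInterval.symm s * t) := by
  have hpi := Real.pi_pos
  have ha : angle s (susp (spherePt m, t)) = s * (Real.pi * t) := by
    rw [angle, susp_coord_zero, Real.arccos_cos (mul_nonneg hpi.le t.2.1)
      (mul_le_of_le_one_right hpi.le t.2.2)]
  have h1 : ∀ t, (susp (spherePt m, t) : EuclideanSpace ℝ (Fin (m + 1 + 1))) 1 =
      Real.sin (Real.pi * t) := fun t => by
    rw [← Fin.succ_zero_eq_one, susp_coord_succ, spherePt_zero, mul_one]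
  have e : Real.pi * ((1 - s) * t) = Real.pi * t - s * (Real.pi * t) := by ring
  refine ext_coord fun i => Fin.cases ?_ (fun j => Fin.cases ?_ (fun j => ?_) j) i
  · simp [twist, ha, h1, e, Real.cos_sub]
    ring
  · simp [twist, ha, h1, e, Real.sin_sub]
    ring
  · simp [twist, spherePt_succ]

theorem twist_spherePt (s : I) : twist (s, spherePt (m + 1)) = spherePt (m + 1) := by
  rw [← susp_zero (spherePt m), twist_susp, mul_zero]

end Sphere

namespace Cones

open Bouquet Sphere

variable {ι W : Type} {κ : W → Type} {m : ℕ}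

/-- A bouquet of `(m+1)`-spheres with cones over bouquets of `m`-spheres attached to the base
point. -/
abbrev ofBouquets (ι : Type) {W : Type} (κ : W → Type) (m : ℕ) : Type :=
  Cones (X := Bouquet ι (m + 1)) fun w => ContinuousMap.const (Bouquet (κ w) m) base

theorem inC_zero_base (w : W) (c : Bouquet (κ w) m) :
    (inC w (c, 0) : ofBouquets ι κ m) = inX base :=
  inC_zero (φ := fun w => ContinuousMap.const (Bouquet (κ w) m) (base : Bouquet ι (m + 1))) w c

/-- The characteristic map of a cone over one of the spheres of a bouquet. -/
noncomputable def inConeSphere (w : W) (k : κ w) : C(Sphere m × I, ofBouquets ι κ m) where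
  toFun x := inC w (inSphere k x.1, x.2)
  continuous_toFun := (continuous_inC w).comp
    (((Bouquet.continuous_inSphere k).comp continuous_fst).prodMk continuous_snd)

theorem inConeSphere_factorsThrough (w : W) (k : κ w) :
    FactorsThrough (inConeSphere w k : C(_, ofBouquets ι κ m)) susp := by
  rintro ⟨y, t⟩ ⟨y', t'⟩ h
  obtain ⟨rfl, rfl | rfl | rfl⟩ := susp_eq h
  · rfl
  · exact (inC_zero_base w _).trans (inC_zero_base w _).symm
  · exact (inC_one w _).trans (inC_one w _).symm

/-- The sphere formed by the cone over a sphere with collapsed base. -/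
noncomputable def coneSphere (w : W) (k : κ w) : C(Sphere (m + 1), ofBouquets ι κ m) :=
  isQuotientMap_susp.lift (inConeSphere w k) (inConeSphere_factorsThrough w k)

theorem coneSphere_susp (w : W) (k : κ w) (y : Sphere m) (t : I) :
    (coneSphere w k (susp (y, t)) : ofBouquets ι κ m) = inC w (inSphere k y, t) :=
  DFunLike.congr_fun (isQuotientMap_susp.lift_comp (inConeSphere w k)
    (inConeSphere_factorsThrough w k)) (y, t)

theorem coneSphere_spherePt (w : W) (k : κ w) :
    (coneSphere w k (spherePt (m + 1)) : ofBouquets ι κ m) = inX base := by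
  rw [← susp_zero (spherePt m), coneSphere_susp, inC_zero_base]

/-- The map from a cone over a bouquet of spheres to a bouquet. -/
noncomputable def coneToBouquet (w : W) :
    C(I × Bouquet (κ w) m, Bouquet (ι ⊕ Σ w, κ w) (m + 1)) where
  toFun x := Bouquet.lift base (fun k y => inSphere (Sum.inr ⟨w, k⟩) (twist (1, susp (y, x.1))))
    (fun k => by simp [twist_susp, susp_zero]) x.2
  continuous_toFun := Bouquet.continuous_prod continuous_const fun k =>
    (continuous_inSphere (Sum.inr ⟨w, k⟩ : ι ⊕ Σ w, κ w)).comp (twist.continuous.comp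
      (continuous_const.prodMk (susp.continuous.comp (continuous_snd.prodMk continuous_fst))))

theorem coneToBouquet_inSphere (w : W) (t : I) (k : κ w) (y : Sphere m) :
    (coneToBouquet w (t, inSphere k y) : Bouquet (ι ⊕ Σ w, κ w) (m + 1)) =
      inSphere (Sum.inr ⟨w, k⟩) (twist (1, susp (y, t))) := rfl

theorem coneToBouquet_zero (w : W) (c : Bouquet (κ w) m) :
    (coneToBouquet w (0, c) : Bouquet (ι ⊕ Σ w, κ w) (m + 1)) = base := by
  rcases c.cases_on with rfl | ⟨k, y, rfl⟩
  · rfl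
  · rw [coneToBouquet_inSphere, susp_zero, twist_spherePt, inSphere_spherePt]

theorem coneToBouquet_one (w : W) (c : Bouquet (κ w) m) :
    (coneToBouquet w (1, c) : Bouquet (ι ⊕ Σ w, κ w) (m + 1)) = base := by
  rcases c.cases_on with rfl | ⟨k, y, rfl⟩
  · rfl
  · rw [coneToBouquet_inSphere, susp_one y (spherePt m), twist_susp, unitInterval.symm_one,
      zero_mul, susp_zero, inSphere_spherePt]

/-- The map from a bouquet with cones attached to the base point to a bouquet. -/
noncomputable def toBouquet : C(ofBouquets ι κ m, Bouquet (ι ⊕ Σ w, κ w) (m + 1)) where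
  toFun := Cones.lift
    (Bouquet.lift base (fun i z => inSphere (Sum.inl i) z) fun i => inSphere_spherePt _)
    (fun w x => coneToBouquet w x.swap) (fun _ => base)
    (fun w c => coneToBouquet_zero w c) (fun w c => coneToBouquet_one w c)
  continuous_toFun := continuous_of
    (Bouquet.continuous_of fun i => by exact continuous_inSphere (Sum.inl i : ι ⊕ Σ w, κ w))
    fun w => (coneToBouquet w).continuous.comp continuous_swap

/-- The map from a bouquet to a bouquet with cones attached to the base point. -/
noncomputable def ofBouquet : C(Bouquet (ι ⊕ Σ w, κ w) (m + 1), ofBouquets ι κ m) where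
  toFun := Bouquet.lift (inX base)
    (Sum.rec (fun i z => inX (inSphere i z)) fun x => coneSphere x.1 x.2) (by
      rintro (i | ⟨w, k⟩)
      · simp
      · exact coneSphere_spherePt w k)
  continuous_toFun := Bouquet.continuous_of (by
    rintro (i | ⟨w, k⟩)
    · exact continuous_inX.comp (continuous_inSphere i)
    · exact (coneSphere w k).continuous)

theorem toBouquet_coneSphere (w : W) (k : κ w) (z : Sphere (m + 1)) :
    toBouquet (coneSphere w k z : ofBouquets ι κ m) =
      inSphere (Sum.inr ⟨w, k⟩) (twist (1, z)) := by
  obtain ⟨⟨y, t⟩, rfl⟩ := susp_surjective z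
  rw [coneSphere_susp]
  rfl

theorem toBouquet_comp_ofBouquet :
    ((toBouquet (ι := ι) (κ := κ) (m := m)).comp ofBouquet).HomotopicRel (.id _) {base} := by
  refine HomotopicRel.symm (.of_continuous (fun x => Bouquet.lift base
    (Sum.rec (fun i z => inSphere (Sum.inl i) z) fun k z => inSphere (Sum.inr k) (twist (x.1, z)))
    ?_ x.2) (Bouquet.continuous_prod continuous_const ?_) ?_ ?_ ?_)
  · rintro (i | k)
    · simp
    · simp [twist_spherePt]
  · rintro (i | k)
    · exact (continuous_inSphere _).comp continuous_snd
    · exact (continuous_inSphere _).comp twist.continuous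
  · intro b
    rcases b.cases_on with rfl | ⟨i | k, z, rfl⟩
    · rfl
    · rfl
    · simp [twist_zero]
  · intro b
    rcases b.cases_on with rfl | ⟨i | k, z, rfl⟩
    · rfl
    · rfl
    · exact (toBouquet_coneSphere k.1 k.2 z).symm
  · rintro s _ rfl
    rfl

theorem ofBouquet_comp_toBouquet :
    ((ofBouquet (ι := ι) (κ := κ) (m := m)).comp toBouquet).HomotopicRel (.id _) {inX base} := by
  let N : ∀ w, (I × I) × Bouquet (κ w) m → ofBouquets ι κ m := fun w x =>
    Bouquet.lift (inC w (base, unitInterval.symm x.1.1 * x.1.2))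
      (fun k y => coneSphere w k (twist (x.1.1, susp (y, x.1.2))))
      (fun k => by rw [twist_susp, coneSphere_susp, inSphere_spherePt]) x.2
  have hN : ∀ w, Continuous (N w) := fun w => by
    refine Bouquet.continuous_prod ?_ fun k => ?_
    · simp only [N, lift_base]
      exact (continuous_inC w).comp (continuous_const.prodMk (by fun_prop))
    · simp only [N, lift_inSphere]
      fun_prop
  refine HomotopicRel.symm (.of_continuous (fun x => Cones.lift inX
    (fun w y => N w ((x.1, y.2), y.1)) (fun w => inC w (base, unitInterval.symm x.1)) ?_ ?_ x.2)
    (Cones.continuous_prod ?_ (fun w => ?_) fun w => ?_) ?_ ?_ ?_)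
  · intro w c
    rcases c.cases_on with rfl | ⟨k, y, rfl⟩
    · simp [N, inC_zero]
    · simp [N, susp_zero, twist_spherePt, coneSphere_spherePt]
  · intro w c
    rcases c.cases_on with rfl | ⟨k, y, rfl⟩
    · simp [N]
    · simp [N, susp_one y (spherePt m), twist_susp, coneSphere_susp]
  · exact continuous_inX.comp continuous_snd
  · simp only [lift_inC]
    exact (hN w).comp (by fun_prop)
  · simp only [lift_apex]
    exact (continuous_inC w).comp (continuous_const.prodMk (by fun_prop))
  · intro b
    rcases b.cases_on with ⟨x, rfl⟩ | ⟨w, c, t, rfl⟩ | ⟨w, rfl⟩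
    · rfl
    · rcases c.cases_on with rfl | ⟨k, y, rfl⟩
      · simp [N]
      · simp [N, twist_zero, coneSphere_susp]
    · simp [inC_one]
  · intro b
    rcases b.cases_on with ⟨x, rfl⟩ | ⟨w, c, t, rfl⟩ | ⟨w, rfl⟩
    · rcases x.cases_on with rfl | ⟨i, z, rfl⟩ <;> rfl
    · rcases c.cases_on with rfl | ⟨k, y, rfl⟩
      · simp only [lift_inC, N, lift_base, unitInterval.symm_one, zero_mul]
        exact inC_zero_base w _
      · rfl
    · simp only [lift_apex, unitInterval.symm_one]
      exact inC_zero_base w _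
  · rintro s _ rfl
    rfl

theorem pointedEquiv_bouquet (ι : Type) (κ : W → Type) (m : ℕ) :
    PointedEquiv (inX base : ofBouquets ι κ m) (base : Bouquet (ι ⊕ Σ w, κ w) (m + 1)) :=
  ⟨toBouquet, ofBouquet, rfl, rfl, ofBouquet_comp_toBouquet, toBouquet_comp_ofBouquet⟩

/-- Attaching cones over spaces equivalent to bouquets of `m`-spheres to a space equivalent to a
bouquet of `(m+1)`-spheres gives a bouquet of `(m+1)`-spheres. -/
theorem pointedEquiv_of_bouquets {X : Type} [TopologicalSpace X] {L : W → Type}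
    [∀ w, TopologicalSpace (L w)] (φ : ∀ w, C(L w, X)) {x : X}
    (hX : PointedEquiv x (base : Bouquet ι (m + 1)))
    (hL : ∀ w, Nonempty (ContinuousMap.HomotopyEquiv (L w) (Bouquet (κ w) m))) :
    PointedEquiv (inX x : Cones φ) (base : Bouquet (ι ⊕ Σ w, κ w) (m + 1)) := by
  refine (pointedEquiv_of_homotopy (fun w => ?_) x).trans
    ((pointedEquiv_const hX hL).trans (pointedEquiv_bouquet ι κ m))
  obtain ⟨f, g, hf, hg, ⟨h1⟩, h2⟩ := hX
  obtain ⟨e⟩ := hL w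
  have a1 : (φ w).Homotopic ((g.comp f).comp ((φ w).comp (e.invFun.comp e.toFun))) := by
    have := ContinuousMap.Homotopic.comp ⟨h1.toHomotopy⟩
      (ContinuousMap.Homotopic.comp (ContinuousMap.Homotopic.refl (φ w)) e.left_inv)
    simpa using this.symm
  have a2 := ((ContinuousMap.Homotopic.comp (ContinuousMap.Homotopic.refl g)
    (homotopic_const_base (f.comp ((φ w).comp e.invFun))))).comp
      (ContinuousMap.Homotopic.refl e.toFun)
  refine a1.trans ?_
  have a3 : (g.comp (ContinuousMap.const (Bouquet (κ w) m) base)).comp e.toFun =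
      ContinuousMap.const (L w) x := ContinuousMap.ext fun _ => hg
  rwa [a3] at a2

end Cones

/-- The points of the realization of the flag complex supported in a given set of vertices. -/
def FlagOn {V : Type} (G : SimpleGraph V) (A : Set V) : Type :=
  {f : V → ℝ // ((∀ v, 0 ≤ f v) ∧ (support f).Finite ∧ G.IsClique (support f) ∧
    ∑ᶠ v, f v = 1) ∧ support f ⊆ A}

namespace FlagOn

variable {V : Type} {G : SimpleGraph V} {A B X : Set V}

instance : TopologicalSpace (FlagOn G A) := inferInstanceAs (TopologicalSpace (Subtype _))

theorem nonneg (f : FlagOn G A) (v : V) : 0 ≤ f.1 v := f.2.1.1 v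

theorem finite_support (f : FlagOn G A) : (support f.1).Finite := f.2.1.2.1

theorem isClique (f : FlagOn G A) : G.IsClique (support f.1) := f.2.1.2.2.1

theorem finsum_eq_one (f : FlagOn G A) : ∑ᶠ v, f.1 v = 1 := f.2.1.2.2.2

theorem support_subset (f : FlagOn G A) : support f.1 ⊆ A := f.2.2

theorem ext {f g : FlagOn G A} (h : ∀ v, f.1 v = g.1 v) : f = g := Subtype.ext (funext h)

theorem continuous_apply (v : V) : Continuous fun f : FlagOn G A => f.1 v :=
  (_root_.continuous_apply v).comp continuous_subtype_val

theorem continuous_of {P : Type*} [TopologicalSpace P] {F : P → FlagOn G A}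
    (h : ∀ v, Continuous fun p => (F p).1 v) : Continuous F :=
  Continuous.subtype_mk (f := fun p => (F p).1) (continuous_pi h) _

/-- The points supported everywhere form the whole realization. -/
def homeomorphUniv (G : SimpleGraph V) : FlagOn G univ ≃ₜ FlagRealization G where
  toFun f := ⟨f.1, f.2.1⟩
  invFun f := ⟨f.1, f.2, subset_univ _⟩
  continuous_toFun := continuous_subtype_val.subtype_mk _
  continuous_invFun := continuous_subtype_val.subtype_mk _

/-- Enlarging the set of vertices. -/
def incl (h : A ⊆ B) : C(FlagOn G A, FlagOn G B) where
  toFun f := ⟨f.1, f.2.1, f.2.2.trans h⟩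
  continuous_toFun := continuous_subtype_val.subtype_mk _

@[simp] theorem incl_val (h : A ⊆ B) (f : FlagOn G A) : (incl h f).1 = f.1 := rfl

/-- A vertex of the flag complex. -/
noncomputable def vert (v : V) (hv : v ∈ A) : FlagOn G A := by
  classical
  exact ⟨Pi.single v 1, ⟨fun w => (Pi.single_nonneg.2 zero_le_one : (0 : V → ℝ) ≤ _) w,
    (finite_singleton v).subset Pi.support_single_subset,
    (G.isClique_singleton v).subset Pi.support_single_subset, by
      rw [finsum_eq_single _ v fun w hw => Pi.single_eq_of_ne hw _, Pi.single_eq_same]⟩,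
    Pi.support_single_subset.trans (singleton_subset_iff.2 hv)⟩

theorem vert_self (v : V) (hv : v ∈ A) : (vert v hv : FlagOn G A).1 v = 1 := by
  simp [vert]

theorem vert_of_ne (v : V) (hv : v ∈ A) {w : V} (h : w ≠ v) :
    (vert v hv : FlagOn G A).1 w = 0 := by
  simp [vert, h]

theorem support_vert (v : V) (hv : v ∈ A) : support (vert v hv : FlagOn G A).1 = {v} := by
  ext w
  by_cases h : w = v
  · subst h
    simp [vert_self]
  · simp [vert_of_ne v hv h, h]

/-- The straight line segment between two points of a common simplex. -/
noncomputable def comb (s : I) (f g : FlagOn G A) (h : G.IsClique (support f.1 ∪ support g.1)) :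
    FlagOn G A :=
  ⟨fun v => (1 - (s : ℝ)) * f.1 v + s * g.1 v, by
    have hsub : support (fun v => (1 - (s : ℝ)) * f.1 v + s * g.1 v) ⊆
        support f.1 ∪ support g.1 := fun v hv => by
      by_contra hc
      simp only [mem_union, mem_support, not_or, not_not] at hc
      exact hv (by simp [hc.1, hc.2])
    refine ⟨⟨fun v => add_nonneg (mul_nonneg (sub_nonneg.2 s.2.2) (f.nonneg v))
      (mul_nonneg s.2.1 (g.nonneg v)), (f.finite_support.union g.finite_support).subset hsub,
      h.subset hsub, ?_⟩, hsub.trans (union_subset f.support_subset g.support_subset)⟩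
    rw [finsum_add_distrib (f.finite_support.subset fun v hv => right_ne_zero_of_mul hv)
      (g.finite_support.subset fun v hv => right_ne_zero_of_mul hv),
      ← mul_finsum, ← mul_finsum, f.finsum_eq_one,
      g.finsum_eq_one]
    ring⟩

theorem comb_val (s : I) (f g : FlagOn G A) (h) (v : V) :
    (comb s f g h).1 v = (1 - (s : ℝ)) * f.1 v + s * g.1 v := rfl

/-- Maps into the realization that are pointwise in a common simplex are homotopic. -/
theorem homotopicRel_of_isClique {Y : Type*} [TopologicalSpace Y] (F₀ F₁ : C(Y, FlagOn G A))
    (h : ∀ y, G.IsClique (support (F₀ y).1 ∪ support (F₁ y).1)) :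
    F₀.HomotopicRel F₁ {y | F₀ y = F₁ y} := by
  refine .of_continuous (fun x => comb x.1 (F₀ x.2) (F₁ x.2) (h x.2)) (continuous_of fun v => ?_)
    (fun y => ext fun v => ?_) (fun y => ext fun v => ?_) fun s y hy => ext fun v => ?_
  · simp only [comb_val]
    have h0 := (continuous_apply (G := G) (A := A) v).comp F₀.continuous
    have h1 := (continuous_apply (G := G) (A := A) v).comp F₁.continuous
    exact ((continuous_const.sub (continuous_subtype_val.comp continuous_fst)).mul
      (h0.comp continuous_snd)).add ((continuous_subtype_val.comp continuous_fst).mul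
      (h1.comp continuous_snd))
  · simp [comb_val]
  · simp [comb_val]
  · rw [comb_val, ← show F₀ y = F₁ y from hy]
    ring

/-- The part of the total mass lying in a set of vertices. -/
noncomputable def mass (B : Set V) (f : FlagOn G A) : ℝ := ∑ᶠ v, B.indicator f.1 v

theorem finite_support_indicator (B : Set V) (f : FlagOn G A) :
    (support (B.indicator f.1)).Finite :=
  f.finite_support.subset (by simp [support_indicator])

theorem mass_add_compl (B : Set V) (f : FlagOn G A) : mass B f + mass Bᶜ f = 1 := by
  rw [mass, mass, ← finsum_add_distrib (finite_support_indicator B f)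
    (finite_support_indicator Bᶜ f)]
  exact (finsum_congr fun v => congrFun (indicator_self_add_compl B f.1) v).trans f.finsum_eq_one

theorem sum_le_mass (B : Set V) (f : FlagOn G A) (F : Finset V) :
    ∑ v ∈ F, B.indicator f.1 v ≤ mass B f := by
  classical
  rw [mass, finsum_eq_sum_of_support_subset (s := F ∪ (finite_support_indicator B f).toFinset) _
    (by simp)]
  exact Finset.sum_le_sum_of_subset_of_nonneg Finset.subset_union_left
    fun v _ _ => indicator_nonneg (fun v _ => f.nonneg v) v

theorem continuous_mass (B : Set V) : Continuous (mass B : FlagOn G A → ℝ) := by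
  rw [continuous_iff_continuousAt]
  intro f
  have hc : ∀ B : Set V, ContinuousAt (fun g : FlagOn G A =>
      ∑ v ∈ f.finite_support.toFinset, B.indicator g.1 v) f := fun B => by
    refine Continuous.continuousAt (continuous_finsetSum _ fun v _ => ?_)
    by_cases hv : v ∈ B
    · simpa [hv] using continuous_apply v
    · simpa [hv] using continuous_const
  have he : ∀ B : Set V, ∑ v ∈ f.finite_support.toFinset, B.indicator f.1 v = mass B f :=
    fun B => (finsum_eq_sum_of_support_subset _ (by simp [support_indicator])).symm
  have h1 := (hc B).tendsto
  have h2 := (tendsto_const_nhds (x := (1 : ℝ))).sub (hc Bᶜ).tendsto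
  rw [he] at h1 h2
  rw [show 1 - mass Bᶜ f = mass B f by linarith [mass_add_compl B f]] at h2
  exact tendsto_of_tendsto_of_tendsto_of_le_of_le h1 h2 (fun g => sum_le_mass B g _)
    fun g => by
      have := sum_le_mass Bᶜ g f.finite_support.toFinset
      have := mass_add_compl B g
      simp only
      linarith

/-- Rescaling the part of a point lying in a set of vertices. -/
noncomputable def restrict (X : Set V) {B : Set V} (f : FlagOn G A) (h : 0 < mass X f)
    (hB : X ∩ support f.1 ⊆ B) : FlagOn G B :=
  ⟨fun v => (mass X f)⁻¹ * X.indicator f.1 v, by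
    have hsub : support (fun v => (mass X f)⁻¹ * X.indicator f.1 v) ⊆ X ∩ support f.1 :=
      fun v hv => by
        have := right_ne_zero_of_mul hv
        rwa [← mem_support, support_indicator] at this
    refine ⟨⟨fun v => mul_nonneg (inv_nonneg.2 h.le) (indicator_nonneg (fun v _ => f.nonneg v) v),
      f.finite_support.subset (hsub.trans inter_subset_right),
      f.isClique.subset (hsub.trans inter_subset_right), ?_⟩, hsub.trans hB⟩
    rw [← mul_finsum]
    exact inv_mul_cancel₀ h.ne'⟩

theorem restrict_val (f : FlagOn G A) (h : 0 < mass X f) (hB : X ∩ support f.1 ⊆ B) (v : V) :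
    (restrict X f h hB).1 v = (mass X f)⁻¹ * X.indicator f.1 v := rfl

theorem support_restrict (f : FlagOn G A) (h : 0 < mass X f) (hB : X ∩ support f.1 ⊆ B) :
    support (restrict X f h hB).1 ⊆ support f.1 := fun v hv => by
  have := right_ne_zero_of_mul (mem_support.1 hv)
  rw [← mem_support, support_indicator] at this
  exact this.2

theorem continuous_restrict {S : Set (FlagOn G A)} (h : ∀ f ∈ S, 0 < mass X f)
    (hB : ∀ f ∈ S, X ∩ support f.1 ⊆ B) :
    Continuous fun f : S => restrict X f.1 (h _ f.2) (hB _ f.2) := continuous_of fun v => by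
  simp only [restrict_val]
  refine (((continuous_mass X).comp continuous_subtype_val).inv₀ fun f => (h _ f.2).ne').mul ?_
  by_cases hv : v ∈ X
  · simp only [indicator_of_mem hv]
    exact (continuous_apply v).comp continuous_subtype_val
  · simp only [indicator_of_notMem hv]
    exact continuous_const

section Attach

variable (hXA : X ⊆ A) (hind : ∀ v ∈ A \ X, ∀ w ∈ A \ X, ¬ G.Adj v w)

include hind in
theorem apply_eq_zero_of_independent {f : FlagOn G A} {w : V} (hw : w ∈ A \ X) (hf : f.1 w ≠ 0)
    {v : V} (hv : v ∉ X) (hvw : v ≠ w) : f.1 v = 0 := by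
  by_contra h
  exact hind v ⟨f.support_subset h, hv⟩ w hw (f.isClique h hf hvw)

include hind in
theorem mass_add_apply {f : FlagOn G A} {w : V} (hw : w ∈ A \ X) (hf : f.1 w ≠ 0) :
    mass X f + f.1 w = 1 := by
  refine Eq.trans ?_ (mass_add_compl X f)
  rw [add_right_inj, mass, finsum_eq_single (Xᶜ.indicator f.1) w fun v hv => ?_]
  · exact (indicator_of_mem hw.2 _).symm
  · by_cases h : v ∈ X
    · simp [h]
    · rw [indicator_of_mem h, apply_eq_zero_of_independent hind hw hf h hv]

theorem mass_eq_one {f : FlagOn G A} (hf : ∀ w ∈ A \ X, f.1 w = 0) : mass X f = 1 := by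
  refine (finsum_congr fun v => ?_).trans f.finsum_eq_one
  by_cases h : v ∈ X
  · simp [h]
  · rw [indicator_of_notMem h]
    by_contra h'
    exact h' (hf v ⟨f.support_subset (Ne.symm h'), h⟩).symm

theorem exists_apply_ne_zero {f : FlagOn G A} (hf : mass X f ≠ 1) : ∃ w ∈ A \ X, f.1 w ≠ 0 := by
  by_contra! h
  exact hf (mass_eq_one h)

theorem inter_support_subset {f : FlagOn G A} {w : V} (hw : w ∈ A \ X) (hf : f.1 w ≠ 0) :
    X ∩ support f.1 ⊆ X ∩ G.neighborSet w := fun v hv => by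
  refine ⟨hv.1, f.isClique hf hv.2 ?_⟩
  rintro rfl
  exact hw.2 hv.1

/-- The inclusion of the part of `X` adjacent to a vertex. -/
abbrev linkIncl (G : SimpleGraph V) (A X : Set V) (w : ↥(A \ X)) :
    C(FlagOn G (X ∩ G.neighborSet w), FlagOn G X) := incl inter_subset_left

theorem isClique_cone (w : ↥(A \ X)) (g : FlagOn G (X ∩ G.neighborSet w)) :
    G.IsClique (support (incl (inter_subset_left.trans hXA) g : FlagOn G A).1 ∪
      support (vert w.1 w.2.1 : FlagOn G A).1) := by
  rw [support_vert, union_singleton]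
  refine g.isClique.insert fun v hv _ => ?_
  exact (g.support_subset hv).2

/-- The map from the attachment of cones to the realization. -/
noncomputable def ofCones : C(Cones (linkIncl G A X), FlagOn G A) where
  toFun := Cones.lift (incl hXA)
    (fun w x => comb x.2 (incl (inter_subset_left.trans hXA) x.1) (vert w.1 w.2.1)
      (isClique_cone hXA w x.1)) (fun w => vert w.1 w.2.1)
    (fun w g => ext fun v => by simp [comb_val]) (fun w g => ext fun v => by simp [comb_val])
  continuous_toFun := Cones.continuous_of (incl hXA).continuous fun w => continuous_of fun v => by
    simp only [Cones.lift_inC, comb_val, incl_val]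
    have := (continuous_apply (G := G) (A := X ∩ G.neighborSet w) v).comp
      (continuous_fst (Y := I))
    exact ((continuous_const.sub (continuous_subtype_val.comp continuous_snd)).mul this).add
      ((continuous_subtype_val.comp continuous_snd).mul continuous_const)

theorem ofCones_inC (w : ↥(A \ X)) (g : FlagOn G (X ∩ G.neighborSet w)) (s : I) :
    ofCones hXA (Cones.inC w (g, s)) = comb s (incl (inter_subset_left.trans hXA) g)
      (vert w.1 w.2.1) (isClique_cone hXA w g) := rfl

theorem ofCones_apex (w : ↥(A \ X)) : 
    (ofCones hXA (Cones.apex w) : FlagOn G A) = vert w.1 w.2.1 := rfl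

include hind in
theorem exists_toCones (f : FlagOn G A) : ∃ z : Cones (linkIncl G A X),
    (∀ h : 2 / 3 < mass X f, z = Cones.inX (restrict X f (by linarith) inter_subset_left)) ∧
    (∀ (w : ↥(A \ X)) (hw : f.1 w ≠ 0) (h : 0 < mass X f), z = Cones.inCone w
      (restrict X f h (inter_support_subset w.2 hw)) (2 - 3 * mass X f)) ∧
    (∀ w : ↥(A \ X), 2 / 3 < f.1 w → z = Cones.apex w) := by
  by_cases h1 : 2 / 3 < mass X f
  · refine ⟨Cones.inX (restrict X f (by linarith) inter_subset_left), fun h => rfl,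
      fun w hw h => ?_, fun w hw => ?_⟩
    · rw [Cones.inCone_of_le (by linarith)]
      rfl
    · have := mass_add_apply hind w.2 (f := f) (by linarith)
      linarith
  · obtain ⟨w, hw, hfw⟩ := exists_apply_ne_zero (f := f) (X := X) (by linarith)
    have huniq : ∀ w' : ↥(A \ X), f.1 w' ≠ 0 → w' = ⟨w, hw⟩ := fun w' hw' => by
      by_contra h
      exact hw' (apply_eq_zero_of_independent hind hw hfw w'.2.2 fun h' => h (Subtype.ext h'))
    by_cases h2 : 0 < mass X f
    · refine ⟨Cones.inCone ⟨w, hw⟩ (restrict X f h2 (inter_support_subset hw hfw))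
        (2 - 3 * mass X f), fun h => (h1 h).elim, fun w' hw' h => ?_, fun w' hw' => ?_⟩
      · obtain rfl := huniq w' hw'
        rfl
      · obtain rfl := huniq w' (by linarith)
        have := mass_add_apply hind hw hfw
        rw [Cones.inCone_of_ge (by simp only at hw'; linarith)]
    · refine ⟨Cones.apex ⟨w, hw⟩, fun h => (h1 h).elim, fun w' hw' h => (h2 h).elim,
        fun w' hw' => ?_⟩
      rw [huniq w' (by linarith)]

theorem restrict_eq_of_mass_eq_one {f : FlagOn G A} {g : FlagOn G B} (h : 0 < mass X f)
    (hB : X ∩ support f.1 ⊆ B) (h1 : mass X f = 1) (hg : ∀ v, X.indicator f.1 v = g.1 v) :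
    restrict X f h hB = g := ext fun v => by
  rw [restrict_val, h1, inv_one, one_mul, hg]

theorem mass_incl (g : FlagOn G X) : mass X (incl hXA g) = 1 :=
  mass_eq_one fun w hw => by
    by_contra h
    exact hw.2 (g.support_subset h)

include hind in
theorem continuous_of_toCones {Φ : FlagOn G A → Cones (linkIncl G A X)}
    (h1 : ∀ f, ∀ h : 2 / 3 < mass X f,
      Φ f = Cones.inX (restrict X f (by linarith) inter_subset_left))
    (h2 : ∀ f, ∀ (w : ↥(A \ X)) (hw : f.1 w ≠ 0) (h : 0 < mass X f), Φ f = Cones.inCone w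
      (restrict X f h (inter_support_subset w.2 hw)) (2 - 3 * mass X f))
    (h3 : ∀ f, ∀ w : ↥(A \ X), 2 / 3 < f.1 w → Φ f = Cones.apex w) : Continuous Φ := by
  have key : ∀ S : Set (FlagOn G A), IsOpen S → Continuous (fun f : S => Φ f.1) →
      ∀ f ∈ S, ContinuousAt Φ f := fun S hS hc f hf =>
    (continuousOn_iff_continuous_domRestrict.2 hc).continuousAt (hS.mem_nhds hf)
  have hm := continuous_mass (G := G) (A := A) X
  rw [continuous_iff_continuousAt]
  intro f
  by_cases hf : 2 / 3 < mass X f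
  · refine key {f | 2 / 3 < mass X f} (isOpen_lt continuous_const hm) ?_ f hf
    refine (Cones.continuous_inX.comp (continuous_restrict (fun f hf => ?_)
      fun f _ => inter_subset_left)).congr fun f => (h1 f.1 f.2).symm
    exact lt_trans (by norm_num) hf
  obtain ⟨w, hw, hfw⟩ := exists_apply_ne_zero (f := f) (X := X) (by linarith)
  by_cases hf0 : 0 < mass X f
  · refine key {f | f.1 w ≠ 0 ∧ 0 < mass X f} ((isOpen_ne.preimage (continuous_apply w)).inter
      (isOpen_lt continuous_const hm)) ?_ f ⟨hfw, hf0⟩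
    exact ((continuous_restrict (fun f hf => hf.2)
      fun f hf => inter_support_subset hw hf.1).inCone (φ := linkIncl G A X) (w := ⟨w, hw⟩)
      (continuous_const.sub (continuous_const.mul (hm.comp continuous_subtype_val)))).congr
      fun f => (h2 f.1 ⟨w, hw⟩ f.2.1 f.2.2).symm
  · refine key {f | 2 / 3 < f.1 w} (isOpen_lt continuous_const (continuous_apply w)) ?_ f ?_
    · exact continuous_const.congr fun f => (h3 f.1 ⟨w, hw⟩ f.2).symm
    · have := mass_add_apply hind hw hfw
      simp only [mem_ofPred_eq]
      linarith

theorem indicator_ofCones_inC (w : ↥(A \ X)) (g : FlagOn G (X ∩ G.neighborSet w)) (s : I)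
    (v : V) : X.indicator (ofCones hXA (Cones.inC w (g, s))).1 v = (1 - (s : ℝ)) * g.1 v := by
  rw [ofCones_inC]
  by_cases hv : v ∈ X
  · rw [indicator_of_mem hv, comb_val, vert_of_ne _ _ (by rintro rfl; exact w.2.2 hv)]
    simp
  · rw [indicator_of_notMem hv]
    by_contra h
    exact hv (g.support_subset (right_ne_zero_of_mul (Ne.symm h))).1

theorem mass_ofCones_inC (w : ↥(A \ X)) (g : FlagOn G (X ∩ G.neighborSet w)) (s : I) :
    mass X (ofCones hXA (Cones.inC w (g, s))) = 1 - (s : ℝ) := by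
  simp only [mass, indicator_ofCones_inC]
  rw [← mul_finsum]
  exact (congrArg _ g.finsum_eq_one).trans (mul_one _)

theorem ofCones_inC_apply_self (w : ↥(A \ X)) (g : FlagOn G (X ∩ G.neighborSet w)) (s : I) :
    (ofCones hXA (Cones.inC w (g, s))).1 w = s := by
  have : g.1 w = 0 := by
    by_contra h
    exact w.2.2 (g.support_subset h).1
  rw [ofCones_inC, comb_val, vert_self, incl_val, this]
  ring

theorem restrict_ofCones_inC (w : ↥(A \ X)) (g : FlagOn G (X ∩ G.neighborSet w)) (s : I)
    (h : 0 < mass X (ofCones hXA (Cones.inC w (g, s))))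
    (hB : X ∩ support (ofCones hXA (Cones.inC w (g, s))).1 ⊆ B) (v : V) :
    (restrict X _ h hB).1 v = g.1 v := by
  have h' := mass_ofCones_inC hXA w g s
  rw [restrict_val, indicator_ofCones_inC, h', inv_mul_cancel_left₀ (h' ▸ h).ne']

include hind in
/-- Attaching an independent set of vertices amounts to attaching cones over their links. -/
theorem pointedEquiv_cones (x : FlagOn G X) :
    PointedEquiv (incl hXA x) (Cones.inX x : Cones (linkIncl G A X)) := by
  choose Φ h1 h2 h3 using exists_toCones (G := G) hind
  let Φ' : C(FlagOn G A, Cones (linkIncl G A X)) := ⟨Φ, continuous_of_toCones hind h1 h2 h3⟩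
  have hΦ : ∀ f, Φ' f = Φ f := fun f => rfl
  have hX : ∀ g : FlagOn G X, Φ' (incl hXA g) = Cones.inX g := fun g => by
    have hm := mass_incl hXA g
    rw [hΦ, h1 _ (by rw [hm]; norm_num)]
    refine congrArg _ (restrict_eq_of_mass_eq_one _ _ hm fun v => ?_)
    by_cases hv : v ∈ X
    · simp [hv]
    · rw [indicator_of_notMem hv]
      by_contra h
      exact hv (g.support_subset (Ne.symm h))
  refine ⟨Φ', ofCones hXA, hX x, rfl, ?_, ?_⟩
  · refine (homotopicRel_of_isClique ((ofCones hXA).comp Φ') (.id _) fun f => ?_).precomp (.id _)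
      (T := {incl hXA x}) ?_
    · refine f.isClique.subset (union_subset ?_ subset_rfl)
      change support (ofCones hXA (Φ f)).1 ⊆ _
      by_cases hf : 2 / 3 < mass X f
      · rw [h1 f hf]
        exact support_restrict (B := X) f (lt_trans (by norm_num) hf) inter_subset_left
      obtain ⟨w, hw, hfw⟩ := exists_apply_ne_zero (f := f) (X := X) (by linarith)
      have hsw : {w} ⊆ support f.1 := singleton_subset_iff.2 hfw
      by_cases hf0 : 0 < mass X f
      · rw [h2 f ⟨w, hw⟩ hfw hf0, Cones.inCone, ofCones_inC]
        refine fun v hv => ?_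
        by_contra hvf
        have hvf : f.1 v = 0 := by simpa using hvf
        refine hv ?_
        rw [comb_val, incl_val, restrict_val, vert_of_ne]
        · simp [indicator, hvf]
        · rintro rfl
          exact hfw hvf
      · rw [h3 f ⟨w, hw⟩, ofCones_apex, support_vert]
        · exact hsw
        · have := mass_add_apply hind hw hfw
          simp only
          linarith
    · rintro _ rfl
      change ofCones hXA (Φ' (incl hXA x)) = incl hXA x
      rw [hX]
      rfl
  · refine (Cones.homotopicRel_id_of_reparam (Φ'.comp (ofCones hXA)) (fun t => 3 * t - 1)
      (by fun_prop) (by norm_num) (by norm_num) hX (fun w g s => ?_) fun w => ?_).precomp (.id _) ?_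
    · change Φ (ofCones hXA (Cones.inC w (g, s))) = _
      have hm := mass_ofCones_inC hXA w g s
      have hs := ofCones_inC_apply_self hXA w g s
      by_cases hs0 : (s : ℝ) = 0
      · rw [h1 _ (by rw [hm, hs0]; norm_num), Cones.inCone_of_le (by rw [hs0]; norm_num)]
        exact congrArg _ (ext (restrict_ofCones_inC hXA w g s _ _))
      by_cases hs1 : (s : ℝ) = 1
      · rw [h3 _ w (by rw [hs, hs1]; norm_num), Cones.inCone_of_ge (by rw [hs1]; norm_num)]
      · have : 0 < 1 - (s : ℝ) := sub_pos.2 (lt_of_le_of_ne s.2.2 hs1)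
        rw [h2 _ w (by rwa [hs]) (by rwa [hm])]
        congr 1
        · exact ext (restrict_ofCones_inC hXA w g s _ _)
        · rw [hm]
          ring
    · change Φ (ofCones hXA (Cones.apex w)) = _
      rw [ofCones_apex, h3 _ w (by rw [vert_self]; norm_num)]
    · rintro _ rfl
      exact mem_range_self x

end Attach

end FlagOn

namespace Sphere

theorem ext_zero {z z' : Sphere 0} (h : (z : EuclideanSpace ℝ (Fin 1)) 0 =
    (z' : EuclideanSpace ℝ (Fin 1)) 0) : z = z' :=
  ext_coord fun i => by rwa [Fin.fin_one_eq_zero i]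

theorem zero_coord (z : Sphere 0) : (z : EuclideanSpace ℝ (Fin 1)) 0 = 1 ∨
    (z : EuclideanSpace ℝ (Fin 1)) 0 = -1 := by
  have := sum_sq z
  rw [Fin.sum_univ_one] at this
  rcases eq_or_eq_neg_of_sq_eq_sq _ (1 : ℝ) (this.trans (one_pow 2).symm) with h | h
  exacts [Or.inl h, Or.inr h]

theorem eq_or_eq_neg (z : Sphere 0) : z = spherePt 0 ∨ z = -spherePt 0 := by
  have h1 : (spherePt 0 : EuclideanSpace ℝ (Fin 1)) 0 = 1 := spherePt_zero
  rcases zero_coord z with h | h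
  · exact Or.inl (ext_zero (h.trans h1.symm))
  · refine Or.inr (ext_zero (h.trans ?_))
    change -1 = -(spherePt 0 : EuclideanSpace ℝ (Fin 1)) 0
    rw [h1]

instance : DiscreteTopology (Sphere 0) := by
  have : Finite (Sphere 0) := by
    exact finite_univ_iff.1 ((toFinite {spherePt 0, -spherePt 0}).subset fun z _ => eq_or_eq_neg z)
  infer_instance

theorem neg_spherePt_ne (n : ℕ) : -spherePt n ≠ spherePt n := ne_neg_of_mem_unit_sphere ℝ _ |>.symm

end Sphere

variable {V : Type} {G : SimpleGraph V} {A : Set V}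

theorem FlagOn.exists_eq_vert (hA : ∀ v ∈ A, ∀ w ∈ A, ¬ G.Adj v w) (f : FlagOn G A) :
    ∃ v : A, f = vert v.1 v.2 := by
  obtain ⟨v, hv⟩ : ∃ v, f.1 v ≠ 0 := by
    by_contra! h
    simpa [h] using f.finsum_eq_one
  have h0 : ∀ w, w ≠ v → f.1 w = 0 := fun w hw => by
    by_contra h
    exact hA w (f.support_subset h) v (f.support_subset hv) (f.isClique h hv hw)
  refine ⟨⟨v, f.support_subset hv⟩, ext fun w => ?_⟩
  by_cases hw : w = v
  · subst hw
    rw [vert_self]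
    exact (finsum_eq_single f.1 w h0).symm.trans f.finsum_eq_one
  · rw [h0 w hw, vert_of_ne _ _ hw]

/-- The flag complex of a nonempty independent set is a bouquet of `0`-spheres. -/
theorem FlagOn.exists_homotopyEquiv_of_independent (hA : ∀ v ∈ A, ∀ w ∈ A, ¬ G.Adj v w)
    (hne : A.Nonempty) :
    ∃ ι : Type, Nonempty (ContinuousMap.HomotopyEquiv (FlagOn G A) (Bouquet ι 0)) := by
  classical
  obtain ⟨a, ha⟩ := hne
  choose p hp using exists_eq_vert (G := G) hA
  have hp' : ∀ v : A, p (vert v.1 v.2) = v := fun v => by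
    by_contra h
    have h1 := vert_self (G := G) v.1 v.2
    rw [hp (vert v.1 v.2), vert_of_ne _ _ fun h' => h (Subtype.ext h'.symm)] at h1
    exact zero_ne_one h1
  have : DiscreteTopology (FlagOn G A) := by
    refine discreteTopology_iff_isOpen_singleton.2 fun f => ?_
    convert isOpen_lt continuous_const (continuous_apply (G := G) (A := A) (p f).1) using 1
    swap
    · exact 0
    ext g
    simp only [mem_singleton_iff, mem_ofPred_eq]
    refine ⟨?_, fun h => ?_⟩
    · rintro rfl
      have h1 := vert_self (G := G) (p g).1 (p g).2
      rw [← hp g] at h1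
      rw [h1]
      exact zero_lt_one
    · rw [hp f, hp g]
      by_contra h'
      rw [hp g, vert_of_ne _ _ fun h'' => h' (by congr 1; exact h''.symm)] at h
      exact h.false
  refine ⟨↥(A \ {a}), ⟨Homeomorph.toHomotopyEquiv
    { toFun := fun f => if h : (p f).1 = a then Bouquet.base else
        Bouquet.inSphere ⟨p f, (p f).2, h⟩ (-spherePt 0)
      invFun := Bouquet.lift (vert a ha)
        (fun i z => if z = spherePt 0 then vert a ha else vert i.1 i.2.1) fun i => if_pos rfl
      left_inv := fun f => ?_
      right_inv := fun b => ?_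
      continuous_toFun := continuous_of_discreteTopology
      continuous_invFun := Bouquet.continuous_of fun i => continuous_of_discreteTopology }⟩⟩
  · dsimp only
    split_ifs with h
    · conv_rhs => rw [hp f]
      simp [h]
    · conv_rhs => rw [hp f]
      simp [Sphere.neg_spherePt_ne]
  · rcases b.cases_on with rfl | ⟨i, z, rfl⟩
    · simp [hp' ⟨a, ha⟩]
    · rcases z.eq_or_eq_neg with rfl | rfl
      · simp [hp' ⟨a, ha⟩]
      · have hi : i.1 ≠ a := i.2.2
        simp [Sphere.neg_spherePt_ne, hp' ⟨i.1, i.2.1⟩, hi]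

/-- The star of a vertex is contractible. -/
theorem FlagOn.pointedEquiv_of_star {v₀ : V} (hv₀ : v₀ ∈ A) (hA : ∀ v ∈ A, v ≠ v₀ → G.Adj v₀ v)
    (n : ℕ) : PointedEquiv (vert v₀ hv₀ : FlagOn G A) (Bouquet.base : Bouquet Empty n) := by
  refine ⟨.const _ Bouquet.base, .const _ (vert v₀ hv₀), rfl, rfl, ?_, ?_⟩
  · refine (homotopicRel_of_isClique (ContinuousMap.const _ (vert v₀ hv₀)) (.id _)
      fun f => ?_).precomp (.id _) ?_
    · rw [ContinuousMap.const_apply, support_vert, singleton_union]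
      exact f.isClique.insert fun v hv hne => hA v (f.support_subset hv) hne.symm
    · rintro _ rfl
      rfl
  · convert HomotopicRel.refl _
    ext b
    rcases b.cases_on with rfl | ⟨⟨⟩, _⟩
    rfl

/-- Every set of at most `2 n` vertices in `A` avoiding a color in `S` has a common neighbor in `A`
of that color. -/
def HasCommonNeighbors {C : Type*} (G : SimpleGraph V) (color : V → C) (n : ℕ) (S : Finset C)
    (A : Set V) : Prop :=
  ∀ i ∈ S, ∀ U : Finset V, ↑U ⊆ A → U.card ≤ 2 * n → (∀ u ∈ U, color u ≠ i) →
    ∃ v ∈ A, color v = i ∧ ∀ u ∈ U, G.Adj v u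

theorem HasCommonNeighbors.exists_homotopyEquiv_bouquet {C : Type*} {color : V → C}
    (hcol : ∀ v w, G.Adj v w → color v ≠ color w) {n : ℕ} {S : Finset C} (hS : S.card = n + 1)
    (hAS : ∀ v ∈ A, color v ∈ S) (hA : HasCommonNeighbors G color n S A) :
    ∃ ι : Type, Nonempty (ContinuousMap.HomotopyEquiv (FlagOn G A) (Bouquet ι n)) := by
  classical
  induction n generalizing S A with
  | zero =>
    obtain ⟨i, rfl⟩ := Finset.card_eq_one.1 hS
    refine FlagOn.exists_homotopyEquiv_of_independent (fun v hv w hw h => hcol v w h ?_) ?_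
    · rw [Finset.mem_singleton.1 (hAS v hv), Finset.mem_singleton.1 (hAS w hw)]
    · obtain ⟨v, hv, -⟩ := hA i (by simp) ∅ (by simp) (by simp) (by simp)
      exact ⟨v, hv⟩
  | succ m ih =>
    obtain ⟨i₀, hi₀⟩ : S.Nonempty := Finset.card_pos.1 (by omega)
    obtain ⟨v₀, hv₀, hc₀, -⟩ := hA i₀ hi₀ ∅ (by simp) (by simp) (by simp)
    let B : Finset C → Set V := fun T => {v | v ∈ A ∧ (v = v₀ ∨ G.Adj v₀ v ∨ color v ∈ T)}
    have link : ∀ T : Finset C, ∀ i ∈ S, (∀ j ∈ S, j ≠ i → j ∉ T → j ≠ i₀) →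
        ∀ w ∈ A, color w = i → ∃ κ : Type, Nonempty (ContinuousMap.HomotopyEquiv
          (FlagOn G (B T ∩ G.neighborSet w)) (Bouquet κ m)) := by
      intro T i hi hT w hw hwi
      refine ih (S := S.erase i) ?_ (fun v hv => ?_) fun j hj U hU hcard hUj => ?_
      · rw [Finset.card_erase_of_mem hi, hS, Nat.add_sub_cancel]
      · exact Finset.mem_erase.2 ⟨hwi ▸ (hcol w v hv.2).symm, hAS v hv.1.1⟩
      · obtain ⟨hji, hjS⟩ := Finset.mem_erase.1 hj
        have hUA : (U : Set V) ⊆ A := fun u hu => (hU hu).1.1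
        by_cases hjT : j ∈ T
        · obtain ⟨v, hv, hvj, hvU⟩ := hA j hjS (insert w U)
            (by simpa [insert_subset_iff, hw] using hUA)
            ((Finset.card_insert_le _ _).trans (by omega))
            (by simpa [hwi, hji.symm] using hUj)
          rw [Finset.forall_mem_insert] at hvU
          exact ⟨v, ⟨⟨hv, Or.inr (Or.inr (hvj ▸ hjT))⟩, hvU.1.symm⟩, hvj, hvU.2⟩
        · have hj₀ := hT j hjS hji hjT
          obtain ⟨v, hv, hvj, hvU⟩ := hA j hjS (insert v₀ (insert w U))
            (by simpa [insert_subset_iff, hw, hv₀] using hUA)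
            ((Finset.card_insert_le _ _).trans
              ((Nat.add_le_add_right (Finset.card_insert_le _ _) 1).trans (by omega)))
            (by simpa [hwi, hji.symm, hc₀, hj₀.symm] using hUj)
          rw [Finset.forall_mem_insert, Finset.forall_mem_insert] at hvU
          exact ⟨v, ⟨⟨hv, Or.inr (Or.inl hvU.1.symm)⟩, hvU.2.1.symm⟩, hvj, hvU.2.2⟩
    let P : Finset C → Prop := fun T => ∃ (ι : Type) (x : FlagOn G (B T)),
      PointedEquiv x (Bouquet.base : Bouquet ι (m + 1))
    have h0 : P ∅ := by
      refine ⟨Empty, _, FlagOn.pointedEquiv_of_star (A := B ∅) (v₀ := v₀) ⟨hv₀, Or.inl rfl⟩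
        (fun v hv hne => ?_) _⟩
      simpa [hne] using hv.2
    have hstep : ∀ T : Finset C, ∀ i ∈ S, (∀ j ∈ S, j ≠ i → j ∉ T → j ≠ i₀) → P T →
        P (insert i T) := by
      rintro T i hi hT ⟨ι, x, hx⟩
      have hsub : B T ⊆ B (insert i T) := fun v hv =>
        ⟨hv.1, hv.2.imp_right (Or.imp_right (Finset.mem_insert_of_mem))⟩
      have hdiff : ∀ w ∈ B (insert i T) \ B T, color w = i := fun w hw => by
        have h1 := hw.1.2
        have h2 : ¬ (w = v₀ ∨ G.Adj v₀ w ∨ color w ∈ T) := fun h => hw.2 ⟨hw.1.1, h⟩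
        rw [Finset.mem_insert] at h1
        tauto
      choose κ hκ using fun w : ↥(B (insert i T) \ B T) =>
        link T i hi hT w w.2.1.1 (hdiff w w.2)
      refine ⟨_, _, (FlagOn.pointedEquiv_cones hsub (fun v hv w hw h => hcol v w h ?_) x).trans
        (Cones.pointedEquiv_of_bouquets (FlagOn.linkIncl G _ _) hx hκ)⟩
      rw [hdiff v hv, hdiff w hw]
    have hall : ∀ T ⊆ S, P (insert i₀ T) := fun T => by
      induction T using Finset.induction with
      | empty => exact fun _ => hstep ∅ i₀ hi₀ (fun j _ h _ => h) h0
      | insert i T _ iht =>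
        intro hT
        rw [Finset.insert_subset_iff] at hT
        rw [Finset.insert_comm]
        refine hstep _ i hT.1 (fun j _ _ h => ?_) (iht hT.2)
        rintro rfl
        exact h (Finset.mem_insert_self _ _)
    have hPS := hall S subset_rfl
    have hB : B (insert i₀ S) = A := subset_antisymm (fun v hv => hv.1) fun v hv =>
      ⟨hv, Or.inr (Or.inr (Finset.mem_insert_of_mem (hAS v hv)))⟩
    simp only [P] at hPS
    rw [hB] at hPS
    obtain ⟨ι, x, hx⟩ := hPS
    exact ⟨ι, hx.nonempty_homotopyEquiv⟩

end

/-- **Statement 19.** Let `h ≥ 1` and let `Γ` be a simple graph whose vertices are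
colored by `h` colors such that adjacent vertices have distinct colors.  Suppose that
for every color `i`: (1) there are at least two vertices of color `i`, and (2) for every
choice of `2(h-1)` vertices of color `≠ i` there are two distinct vertices of color `i`
adjacent to each of them.  Then the flag complex `K(Γ)` has the homotopy type of a
bouquet of `(h-1)`-spheres. -/
theorem flagComplex_homotopy_bouquet {V : Type} (G : SimpleGraph V) (h : ℕ)
    (hh : 1 ≤ h) (color : V → Fin h)
    (hadj : ∀ v w, G.Adj v w → color v ≠ color w)
    (h1 : ∀ i : Fin h, ∃ v w, v ≠ w ∧ color v = i ∧ color w = i)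
    (h2 : ∀ i : Fin h, ∀ u : Fin (2 * (h - 1)) → V, (∀ j, color (u j) ≠ i) →
      ∃ v w, v ≠ w ∧ color v = i ∧ color w = i ∧
        ∀ j, G.Adj v (u j) ∧ G.Adj w (u j)) :
    ∃ ι : Type, Nonempty (ContinuousMap.HomotopyEquiv (FlagRealization G)
      (Bouquet ι (h - 1))) := by
  classical
  obtain ⟨n, rfl⟩ : ∃ n, h = n + 1 := ⟨h - 1, by omega⟩
  have key : HasCommonNeighbors G color n Finset.univ Set.univ := by
    intro i _ U _ hU hUi
    rcases U.eq_empty_or_nonempty with rfl | ⟨u₀, hu₀⟩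
    · obtain ⟨v, -, -, hv, -⟩ := h1 i
      exact ⟨v, trivial, hv, by simp⟩
    · let u : Fin (2 * n) → V := fun j =>
        if hj : (j : ℕ) < U.card then (U.equivFin.symm ⟨j, hj⟩ : V) else u₀
      obtain ⟨v, _, -, hv, -, hvu⟩ := h2 i u fun j => by
        simp only [u]
        split_ifs with hj
        · exact hUi _ (U.equivFin.symm ⟨j, hj⟩).2
        · exact hUi _ hu₀
      refine ⟨v, trivial, hv, fun w hw => ?_⟩
      have hlt := (U.equivFin ⟨w, hw⟩).2
      have := (hvu ⟨U.equivFin ⟨w, hw⟩, hlt.trans_le hU⟩).1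
      simpa [u] using this
  obtain ⟨ι, ⟨e⟩⟩ := key.exists_homotopyEquiv_bouquet hadj (by simp) fun _ _ => Finset.mem_univ _
  exact ⟨ι, ⟨(FlagOn.homeomorphUniv G).symm.toHomotopyEquiv.trans e⟩⟩
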